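/- arXiv:2111.13206 — 2 statements merged into one kernel-verified Lean document; each statement's English description precedes it below -/
import Mathlib

section
/- Let (X_t : t ∈ ℝ) be a zero-mean stationary Gaussian process with continuous paths and covariance kernel R(t) = ∫ e^{itx} μ(dx), where μ is a finite non-null symmetric measure on ℝ with ∫ x² μ(dx) < ∞ and μ(ℝ \ {0}) > 0. Define τ_u^+ = inf{t ≥ 0 : X_t ≤ u} and τ_u^- = sup{t ≤ 0 : X_t ≤ u}. Then, conditionally on [X_0 > u], as u → ∞, u(τ_u^+ − τ_u^-) converges in distribution to 2 (R(0)/√(−R''(0))) √(Z² + 2T*), where Z is standard normal and T* is standard exponential, independent of each other. -/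
open MeasureTheory ProbabilityTheory Filter

/-- A real-valued stochastic process is a (zero-mean) Gaussian process if every finite
linear combination of its values has a centered Gaussian distribution. -/
def IsZeroMeanGaussianProcess {Ω : Type*} [MeasurableSpace Ω] (P : Measure Ω)
    (X : ℝ → Ω → ℝ) : Prop :=
  (∀ t, Measurable (X t)) ∧
  ∀ (n : ℕ) (t : Fin n → ℝ) (c : Fin n → ℝ),
    ∃ v : NNReal, P.map (fun ω => ∑ i, c i * X (t i) ω) = gaussianReal 0 v

open Topology

section Spectral

variable {μ : Measure ℝ} [IsFiniteMeasure μ] {R : ℝ → ℝ}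

lemma integrable_cos_mul (μ : Measure ℝ) [IsFiniteMeasure μ] (t : ℝ) :
    Integrable (fun x => Real.cos (t * x)) μ :=
  .of_bound (by fun_prop) 1 (.of_forall fun x => by
    rw [Real.norm_eq_abs]; exact Real.abs_cos_le_one _)

lemma covariance_eq_integral_cos
    (hR : ∀ t : ℝ, (R t : ℂ) = ∫ x : ℝ, Complex.exp (Complex.I * t * x) ∂μ) (t : ℝ) :
    R t = ∫ x, Real.cos (t * x) ∂μ := by
  have hint : Integrable (fun x : ℝ => Complex.exp (Complex.I * t * x)) μ :=
    .of_bound (by fun_prop) 1 (.of_forall fun x => by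
      rw [show Complex.I * (t : ℂ) * x = ((t * x : ℝ) : ℂ) * Complex.I by push_cast; ring,
        Complex.norm_exp_ofReal_mul_I])
  have h := congrArg Complex.re (hR t)
  rw [Complex.ofReal_re] at h
  rw [h]
  have := integral_re (𝕜 := ℂ) hint
  simp only [RCLike.re_eq_complex_re] at this
  rw [← this]
  refine integral_congr_ae (.of_forall fun x => ?_)
  simp only
  rw [show Complex.I * (t : ℂ) * x = ((t * x : ℝ) : ℂ) * Complex.I by push_cast; ring,
    Complex.exp_ofReal_mul_I_re]

lemma integrable_id_of_sq (hm : Integrable (fun x : ℝ => x ^ 2) μ) :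
    Integrable (fun x : ℝ => |x|) μ := by
  refine ((integrable_const (1 : ℝ)).add hm).mono' (by fun_prop) (.of_forall fun x => ?_)
  simp only [Real.norm_eq_abs, abs_abs, Pi.add_apply]
  nlinarith [sq_nonneg (|x| - 1), sq_abs x, abs_nonneg x]

lemma deriv_deriv_integral_cos (hm : Integrable (fun x : ℝ => x ^ 2) μ)
    (hR : ∀ t, R t = ∫ x, Real.cos (t * x) ∂μ) :
    deriv (deriv R) 0 = -∫ x, x ^ 2 ∂μ := by
  have h1 : ∀ t, HasDerivAt R (∫ x, -(x * Real.sin (t * x)) ∂μ) t := by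
    intro t
    rw [show R = fun t => ∫ x, Real.cos (t * x) ∂μ from funext hR]
    refine (hasDerivAt_integral_of_dominated_loc_of_deriv_le (bound := fun x => |x|)
      (F' := fun t x => -(x * Real.sin (t * x))) univ_mem (.of_forall fun t => by fun_prop)
      (integrable_cos_mul μ t) (by fun_prop) (.of_forall fun x t _ => ?_)
      (integrable_id_of_sq hm) (.of_forall fun x t _ => ?_)).2
    · rw [norm_neg, Real.norm_eq_abs, abs_mul]
      exact mul_le_of_le_one_right (abs_nonneg _) (Real.abs_sin_le_one _)
    · have := (Real.hasDerivAt_cos (t * x)).comp t ((hasDerivAt_id t).mul_const x)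
      convert! this using 1
      ring
  have h2 : HasDerivAt (fun t => ∫ x, -(x * Real.sin (t * x)) ∂μ)
      (∫ x, -(x * (Real.cos (0 * x) * x)) ∂μ) 0 := by
    refine (hasDerivAt_integral_of_dominated_loc_of_deriv_le (bound := fun x => x ^ 2)
      (F' := fun t x => -(x * (Real.cos (t * x) * x))) univ_mem (.of_forall fun t => by fun_prop)
      (by simp) (by fun_prop) (.of_forall fun x t _ => ?_)
      hm (.of_forall fun x t _ => ?_)).2
    · rw [norm_neg, Real.norm_eq_abs, show x * (Real.cos (t * x) * x) = x ^ 2 * Real.cos (t * x) by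
        ring, abs_mul, abs_of_nonneg (sq_nonneg x)]
      exact mul_le_of_le_one_right (sq_nonneg _) (Real.abs_cos_le_one _)
    · have := (Real.hasDerivAt_sin (t * x)).comp t ((hasDerivAt_id t).mul_const x)
      convert! (this.const_mul x).neg using 1
      ring
  rw [show deriv R = fun t => ∫ x, -(x * Real.sin (t * x)) ∂μ from funext fun t => (h1 t).deriv,
    h2.deriv, ← integral_neg]
  congr 1 with x
  simp; ring

/-- The second-order expansion at the origin of a covariance function with finite second spectral
moment. -/
lemma tendsto_integral_cos_sub_div_sq (hm : Integrable (fun x : ℝ => x ^ 2) μ)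
    (hR : ∀ t, R t = ∫ x, Real.cos (t * x) ∂μ) :
    Tendsto (fun s => (R 0 - R s) / s ^ 2) (𝓝[≠] 0) (𝓝 ((∫ x, x ^ 2 ∂μ) / 2)) := by
  have e : ∀ s, (R 0 - R s) / s ^ 2 = ∫ x, (1 - Real.cos (s * x)) / s ^ 2 ∂μ := by
    intro s
    rw [integral_div, integral_sub (integrable_const _) (integrable_cos_mul μ s), ← hR s, hR 0]
    simp
  simp_rw [e, ← integral_div]
  refine tendsto_integral_filter_of_dominated_convergence (fun x => x ^ 2 / 2)
    (.of_forall fun s => by fun_prop) (.of_forall fun s => .of_forall fun x => ?_) (hm.div_const 2)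
    (.of_forall fun x => ?_)
  · have h1 := Real.one_sub_sq_div_two_le_cos (x := s * x)
    have h2 := Real.cos_le_one (s * x)
    rw [Real.norm_eq_abs, abs_of_nonneg (div_nonneg (by linarith) (sq_nonneg s))]
    rcases eq_or_ne s 0 with rfl | hs
    · simp; positivity
    · rw [div_le_iff₀ (by positivity)]
      nlinarith
  · have hsin : Tendsto (fun s => Real.sin (s * (x / 2)) / s) (𝓝[≠] 0) (𝓝 (x / 2)) := by
      have h : HasDerivAt (fun s => Real.sin (s * (x / 2))) (x / 2) 0 := by
        have := (Real.hasDerivAt_sin (0 * (x / 2))).comp 0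
          ((hasDerivAt_id (0 : ℝ)).mul_const (x / 2))
        simpa [Function.comp_def] using! this
      have := h.tendsto_slope
      refine this.congr fun s => ?_
      simp [slope_def_field]
    have := (hsin.pow 2).const_mul 2
    convert! this using 1
    · ext s
      rw [div_pow, ← mul_div_assoc]
      congr 1
      have h := Real.cos_sq (s * (x / 2))
      rw [show 2 * (s * (x / 2)) = s * x by ring] at h
      nlinarith [Real.sin_sq_add_cos_sq (s * (x / 2))]
    · congr 1; ring

end Spectral

section Gaussian

variable {Ω : Type*} [MeasurableSpace Ω] {P : Measure Ω} {X : ℝ → Ω → ℝ}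

namespace IsZeroMeanGaussianProcess

lemma measurable_of_mem_span (hX : IsZeroMeanGaussianProcess P X) {A : Ω → ℝ}
    (hA : A ∈ Submodule.span ℝ (Set.range X)) : Measurable A := by
  induction hA using Submodule.span_induction with
  | mem A h => obtain ⟨t, rfl⟩ := h; exact hX.1 t
  | zero => exact measurable_const
  | add A B _ _ hA hB => exact hA.add hB
  | smul c A _ hA => exact hA.const_smul c

lemma exists_map_eq (hX : IsZeroMeanGaussianProcess P X) {A : Ω → ℝ}
    (hA : A ∈ Submodule.span ℝ (Set.range X)) :
    ∃ v : NNReal, P.map A = gaussianReal 0 v := by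
  obtain ⟨n, c, g, rfl⟩ := Submodule.mem_span_set'.1 hA
  choose t ht using fun i => (g i).2
  obtain ⟨v, hv⟩ := hX.2 n t c
  refine ⟨v, ?_⟩
  rw [← hv]
  congr 1
  ext ω
  simp [← ht]

lemma memLp_two (hX : IsZeroMeanGaussianProcess P X) {A : Ω → ℝ}
    (hA : A ∈ Submodule.span ℝ (Set.range X)) : MemLp A 2 P := by
  obtain ⟨v, hv⟩ := hX.exists_map_eq hA
  have h := memLp_id_gaussianReal' (μ := 0) (v := v) 2 (by simp)
  rw [← hv] at h
  exact (memLp_map_measure_iff h.1 (hX.measurable_of_mem_span hA).aemeasurable).1 h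

lemma integral_eq_zero (hX : IsZeroMeanGaussianProcess P X) {A : Ω → ℝ}
    (hA : A ∈ Submodule.span ℝ (Set.range X)) : ∫ ω, A ω ∂P = 0 := by
  obtain ⟨v, hv⟩ := hX.exists_map_eq hA
  have h := integral_map (μ := P) (hX.measurable_of_mem_span hA).aemeasurable
    (f := fun x : ℝ => x) (by fun_prop)
  rw [← h, hv, integral_id_gaussianReal]

lemma integrable_mul (hX : IsZeroMeanGaussianProcess P X) {A B : Ω → ℝ}
    (hA : A ∈ Submodule.span ℝ (Set.range X)) (hB : B ∈ Submodule.span ℝ (Set.range X)) :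
    Integrable (fun ω => A ω * B ω) P :=
  (hX.memLp_two hA).integrable_mul (hX.memLp_two hB)

lemma map_eq (hX : IsZeroMeanGaussianProcess P X) {A : Ω → ℝ}
    (hA : A ∈ Submodule.span ℝ (Set.range X)) {w : NNReal} (hw : ∫ ω, A ω ^ 2 ∂P = w) :
    P.map A = gaussianReal 0 w := by
  obtain ⟨v, hv⟩ := hX.exists_map_eq hA
  have hvar : (v : ℝ) = w := by
    rw [← hw, ← variance_id_gaussianReal (μ := 0), ← hv,
      variance_id_map (hX.measurable_of_mem_span hA).aemeasurable,
      variance_of_integral_eq_zero (hX.measurable_of_mem_span hA).aemeasurable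
        (hX.integral_eq_zero hA)]
  rw [hv, NNReal.coe_injective hvar]

lemma indepFun [IsProbabilityMeasure P] (hX : IsZeroMeanGaussianProcess P X) {A B : Ω → ℝ}
    (hA : A ∈ Submodule.span ℝ (Set.range X)) (hB : B ∈ Submodule.span ℝ (Set.range X))
    (hAB : ∫ ω, A ω * B ω ∂P = 0) : IndepFun A B P := by
  have hmA := hX.measurable_of_mem_span hA
  have hmB := hX.measurable_of_mem_span hB
  refine HasGaussianLaw.indepFun_of_covariance_eq_zero ⟨?_⟩ ?_
  · refine isGaussian_of_map_eq_gaussianReal fun L => ?_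
    have hL : ∀ p : ℝ × ℝ, L p = L (1, 0) * p.1 + L (0, 1) * p.2 := by
      intro p
      have : p = p.1 • ((1, 0) : ℝ × ℝ) + p.2 • ((0, 1) : ℝ × ℝ) := by ext <;> simp
      conv_lhs => rw [this, map_add, map_smul, map_smul]
      simp only [smul_eq_mul]; ring
    obtain ⟨v, hv⟩ := hX.exists_map_eq (add_mem (Submodule.smul_mem _ (L (1, 0)) hA)
      (Submodule.smul_mem _ (L (0, 1)) hB))
    refine ⟨0, v, ?_⟩
    rw [← hv, Measure.map_map (by fun_prop) (by fun_prop)]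
    congr 1
    ext ω
    exact hL (A ω, B ω)
  · rw [covariance_eq_sub (hX.memLp_two hA) (hX.memLp_two hB), hX.integral_eq_zero hA]
    simpa using hAB

/-- Pythagoras: removing from `A` its orthogonal projection decreases the second moment. -/
lemma integral_sq_le (hX : IsZeroMeanGaussianProcess P X) {A B C : Ω → ℝ}
    (hB : B ∈ Submodule.span ℝ (Set.range X)) (hC : C ∈ Submodule.span ℝ (Set.range X))
    (hBC : ∫ ω, B ω * C ω ∂P = 0) (k : ℝ) (hA : ∀ ω, A ω = B ω + k * C ω) :
    ∫ ω, B ω ^ 2 ∂P ≤ ∫ ω, A ω ^ 2 ∂P := by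
  have e : ∀ ω, A ω ^ 2 = B ω * B ω + (2 * k) * (B ω * C ω) + k ^ 2 * (C ω * C ω) := by
    intro ω; rw [hA]; ring
  have hint : Integrable (fun ω => B ω * B ω + (2 * k) * (B ω * C ω)) P :=
    (hX.integrable_mul hB hB).add ((hX.integrable_mul hB hC).const_mul _)
  simp_rw [e]
  rw [integral_add hint ((hX.integrable_mul hC hC).const_mul _),
    integral_add (hX.integrable_mul hB hB) ((hX.integrable_mul hB hC).const_mul _),
    integral_const_mul, hBC, integral_const_mul]
  simp_rw [← sq]
  have : 0 ≤ ∫ ω, C ω ^ 2 ∂P := integral_nonneg fun ω => sq_nonneg _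
  nlinarith [mul_nonneg (sq_nonneg k) this]

/-- The spectral isometry for finite linear combinations. -/
lemma integral_sum_sq (hX : IsZeroMeanGaussianProcess P X) {μ : Measure ℝ} [IsFiniteMeasure μ]
    (hcov : ∀ s t, ∫ ω, X s ω * X t ω ∂P = ∫ x, Real.cos ((s - t) * x) ∂μ)
    {n : ℕ} (c t : Fin n → ℝ) :
    ∫ ω, (∑ i, c i * X (t i) ω) ^ 2 ∂P =
      ∫ x, ((∑ i, c i * Real.cos (t i * x)) ^ 2 + (∑ i, c i * Real.sin (t i * x)) ^ 2) ∂μ := by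
  have hmem : ∀ s, X s ∈ Submodule.span ℝ (Set.range X) := fun s =>
    Submodule.subset_span ⟨s, rfl⟩
  have e1 : ∀ ω, (∑ i, c i * X (t i) ω) ^ 2 =
      ∑ i, ∑ j, c i * c j * (X (t i) ω * X (t j) ω) := by
    intro ω
    rw [sq, Finset.sum_mul_sum]
    exact Finset.sum_congr rfl fun i _ => Finset.sum_congr rfl fun j _ => by ring
  have e2 : ∀ x, (∑ i, c i * Real.cos (t i * x)) ^ 2 + (∑ i, c i * Real.sin (t i * x)) ^ 2 =
      ∑ i, ∑ j, c i * c j * Real.cos ((t i - t j) * x) := by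
    intro x
    rw [sq, sq, Finset.sum_mul_sum, Finset.sum_mul_sum, ← Finset.sum_add_distrib]
    refine Finset.sum_congr rfl fun i _ => ?_
    rw [← Finset.sum_add_distrib]
    refine Finset.sum_congr rfl fun j _ => ?_
    rw [sub_mul, Real.cos_sub]; ring
  simp_rw [e1, e2]
  rw [integral_finsetSum _ fun i _ => integrable_finsetSum _ fun j _ =>
      (hX.integrable_mul (hmem _) (hmem _)).const_mul _,
    integral_finsetSum _ fun i _ => integrable_finsetSum _ fun j _ =>
      (integrable_cos_mul μ _).const_mul _]
  refine Finset.sum_congr rfl fun i _ => ?_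
  rw [integral_finsetSum _ fun j _ => (hX.integrable_mul (hmem _) (hmem _)).const_mul _,
    integral_finsetSum _ fun j _ => (integrable_cos_mul μ _).const_mul _]
  refine Finset.sum_congr rfl fun j _ => ?_
  rw [integral_const_mul, integral_const_mul, hcov]

end IsZeroMeanGaussianProcess

end Gaussian

section Chaining

lemma abs_le_of_dyadic_increments {z : ℝ → ℝ} (hz : Continuous z) (h0 : z 0 = 0) {a : ℕ → ℝ}
    (ha : ∀ n, 0 ≤ a n) {δ : ℝ} (hδ : ∀ n, ∑ m ∈ Finset.range n, a m ≤ δ)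
    (hinc : ∀ n k : ℕ, k < 2 ^ n → |z ((k + 1 : ℕ) / 2 ^ n) - z (k / 2 ^ n)| ≤ a n)
    {t : ℝ} (ht : t ∈ Set.Icc (0 : ℝ) 1) : |z t| ≤ δ := by
  have key : ∀ n k : ℕ, k ≤ 2 ^ n → |z (k / 2 ^ n)| ≤ ∑ m ∈ Finset.range (n + 1), a m := by
    intro n
    induction n with
    | zero =>
      intro k hk
      have h1 := hinc 0 0 (by norm_num)
      have : k = 0 ∨ k = 1 := by simp at hk; omega
      rcases this with rfl | rfl
      · simpa [h0] using ha 0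
      · simpa [h0] using h1
    | succ n ih =>
      have heven : ∀ j : ℕ, ((2 * j : ℕ) : ℝ) / 2 ^ (n + 1) = j / 2 ^ n := by
        intro j; push_cast; rw [pow_succ]; field_simp
      intro k hk
      rw [Finset.sum_range_succ]
      rcases Nat.even_or_odd' k with ⟨j, rfl | rfl⟩
      · rw [heven]
        have := ih j (by rw [pow_succ] at hk; omega)
        linarith [ha (n + 1)]
      · have h1 := ih j (by rw [pow_succ] at hk; omega)
        have h2 := hinc (n + 1) (2 * j) (by omega)
        rw [heven] at h2
        have := abs_sub_abs_le_abs_sub (z ((2 * j + 1 : ℕ) / 2 ^ (n + 1))) (z (j / 2 ^ n))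
        linarith
  have hlim : Tendsto (fun n : ℕ => |z ((⌊t * 2 ^ n⌋₊ : ℕ) / 2 ^ n)|) atTop (𝓝 |z t|) := by
    refine (hz.abs.tendsto t).comp ?_
    exact (tendsto_nat_floor_mul_div_atTop ht.1).comp
      (tendsto_pow_atTop_atTop_of_one_lt (one_lt_two : (1 : ℝ) < 2))
  refine le_of_tendsto hlim (.of_forall fun n => (key n _ ?_).trans (hδ _))
  have : t * 2 ^ n ≤ ((2 ^ n : ℕ) : ℝ) := by
    push_cast
    exact mul_le_of_le_one_left (by positivity) ht.2
  exact Nat.floor_le_of_le this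

variable {Ω : Type*} [MeasurableSpace Ω]

/-- A maximal inequality for continuous processes whose increments are Lipschitz in `L²`, proved by
chaining along the dyadic points. -/
lemma measure_exists_lt_abs_le {Q : Measure Ω} {Z : ℝ → Ω → ℝ}
    (hZ : ∀ ω, Continuous fun t => Z t ω) (h0 : ∀ ω, Z 0 ω = 0) {B δ : ℝ} (hB : 0 ≤ B)
    (hδ : 0 < δ)
    (hinc : ∀ s ∈ Set.Icc (0 : ℝ) 1, ∀ t ∈ Set.Icc (0 : ℝ) 1, ∀ a > 0,
      Q {ω | a ≤ |Z t ω - Z s ω|} ≤ ENNReal.ofReal (B * (t - s) ^ 2 / a ^ 2)) :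
    Q {ω | ∃ t ∈ Set.Icc (0 : ℝ) 1, δ < |Z t ω|} ≤ ENNReal.ofReal (800 / 7 * B / δ ^ 2) := by
  set a : ℕ → ℝ := fun n => δ / 5 * (4 / 5) ^ n with ha
  have hapos : ∀ n, 0 < a n := fun n => by positivity
  have hsum : ∀ n, ∑ m ∈ Finset.range n, a m ≤ δ := by
    intro n
    have : HasSum a δ := by
      have := (hasSum_geometric_of_lt_one (r := (4 / 5 : ℝ)) (by norm_num)
        (by norm_num)).mul_left (δ / 5)
      rwa [show δ / 5 * (1 - 4 / 5)⁻¹ = δ by norm_num] at this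
    exact sum_le_hasSum _ (fun i _ => (hapos i).le) this
  have hsub : {ω | ∃ t ∈ Set.Icc (0 : ℝ) 1, δ < |Z t ω|} ⊆
      ⋃ n : ℕ, ⋃ k ∈ Finset.range (2 ^ n),
        {ω | a n ≤ |Z ((k + 1 : ℕ) / 2 ^ n) ω - Z (k / 2 ^ n) ω|} := by
    rintro ω ⟨t, ht, hlt⟩
    by_contra hcon
    simp only [Set.mem_iUnion, Finset.mem_range, Set.mem_ofPred_eq, not_exists, not_le] at hcon
    exact absurd (abs_le_of_dyadic_increments (hZ ω) (h0 ω) (fun n => (hapos n).le) hsum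
      (fun n k hk => (hcon n k hk).le) ht) (not_le.2 hlt)
  have hterm : ∀ n : ℕ, Q (⋃ k ∈ Finset.range (2 ^ n),
        {ω | a n ≤ |Z ((k + 1 : ℕ) / 2 ^ n) ω - Z (k / 2 ^ n) ω|}) ≤
      ENNReal.ofReal (25 * B / δ ^ 2 * (25 / 32) ^ n) := by
    intro n
    refine (measure_biUnion_finset_le _ _).trans ?_
    have : ∀ k ∈ Finset.range (2 ^ n),
        Q {ω | a n ≤ |Z ((k + 1 : ℕ) / 2 ^ n) ω - Z (k / 2 ^ n) ω|} ≤
          ENNReal.ofReal (B * (1 / 2 ^ n) ^ 2 / a n ^ 2) := by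
      intro k hk
      have hk' : ((k + 1 : ℕ) : ℝ) ≤ 2 ^ n := by
        exact_mod_cast Nat.succ_le_of_lt (Finset.mem_range.1 hk)
      have hk2 : (k : ℝ) ≤ 2 ^ n := le_trans (by push_cast; linarith) hk'
      refine (hinc _ ⟨by positivity, (div_le_one (by positivity)).2 hk2⟩ _
        ⟨by positivity, (div_le_one (by positivity)).2 hk'⟩ _ (hapos n)).trans (le_of_eq ?_)
      congr 4
      push_cast; ring
    refine (Finset.sum_le_sum this).trans (le_of_eq ?_)
    rw [Finset.sum_const, Finset.card_range, nsmul_eq_mul, ← ENNReal.ofReal_natCast,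
      ← ENNReal.ofReal_mul (by positivity)]
    congr 1
    have h32 : (32 : ℝ) ^ n = 2 ^ n * (4 ^ n) ^ 2 := by
      rw [← pow_mul, mul_comm n 2, pow_mul, ← mul_pow]; norm_num
    have h25 : (25 : ℝ) ^ n = (5 ^ n) ^ 2 := by rw [← pow_mul, mul_comm n 2, pow_mul]; norm_num
    simp only [ha, div_pow, mul_pow, h32, h25]
    push_cast
    field_simp
    norm_num
  have hS : HasSum (fun n : ℕ => 25 * B / δ ^ 2 * (25 / 32 : ℝ) ^ n) (800 / 7 * B / δ ^ 2) := by
    have := (hasSum_geometric_of_lt_one (r := (25 / 32 : ℝ)) (by norm_num)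
        (by norm_num)).mul_left (25 * B / δ ^ 2)
    rwa [show 25 * B / δ ^ 2 * (1 - 25 / 32)⁻¹ = 800 / 7 * B / δ ^ 2 by norm_num; ring] at this
  calc _ ≤ _ := measure_mono hsub
    _ ≤ _ := measure_iUnion_le _
    _ ≤ ∑' n : ℕ, ENNReal.ofReal (25 * B / δ ^ 2 * (25 / 32) ^ n) := ENNReal.tsum_le_tsum hterm
    _ = _ := by
      rw [← ENNReal.ofReal_tsum_of_nonneg (fun n => by positivity) hS.summable, hS.tsum_eq]

end Chaining

section Hitting

lemma sSup_nonpos_eq_neg_sInf (x : ℝ → ℝ) (u : ℝ) :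
    sSup {t : ℝ | t ≤ 0 ∧ x t ≤ u} = -sInf {t : ℝ | 0 ≤ t ∧ x (-t) ≤ u} := by
  rw [Real.sInf_def, neg_neg]
  congr 1
  ext t
  simp

lemma measurableSet_exists_mem_Icc_le {Ω : Type*} [MeasurableSpace Ω] {x : ℝ → Ω → ℝ}
    (hm : ∀ t, Measurable (x t)) (hc : ∀ ω, Continuous fun t => x t ω) (u : ℝ) {a : ℝ}
    (ha : 0 ≤ a) : MeasurableSet {ω | ∃ t ∈ Set.Icc 0 a, x t ω ≤ u} := by
  have : Nonempty (Set.Icc 0 a) := ⟨⟨0, le_rfl, ha⟩⟩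
  have e : {ω | ∃ t ∈ Set.Icc 0 a, x t ω ≤ u} = ⋂ n : ℕ, ⋃ k : ℕ,
      {ω | x (TopologicalSpace.denseSeq (Set.Icc 0 a) k) ω < u + 1 / (n + 1)} := by
    ext ω
    simp only [Set.mem_ofPred_eq, Set.mem_iInter, Set.mem_iUnion]
    constructor
    · rintro ⟨t, ht, htu⟩ n
      have hopen : IsOpen {s : Set.Icc 0 a | x s ω < u + 1 / (n + 1)} :=
        isOpen_lt ((hc ω).comp continuous_subtype_val) continuous_const
      obtain ⟨k, hk⟩ := (TopologicalSpace.denseRange_denseSeq (Set.Icc 0 a)).exists_mem_open hopen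
        ⟨⟨t, ht⟩, lt_of_le_of_lt htu (by simp; positivity)⟩
      exact ⟨k, hk⟩
    · intro h
      obtain ⟨t, ht, hmin⟩ := isCompact_Icc.exists_isMinOn (Set.nonempty_Icc.2 ha)
        (hc ω).continuousOn
      refine ⟨t, ht, ?_⟩
      have hlim : Tendsto (fun n : ℕ => u + 1 / ((n : ℝ) + 1)) atTop (𝓝 (u + 0)) :=
        tendsto_const_nhds.add tendsto_one_div_add_atTop_nhds_zero_nat
      rw [add_zero] at hlim
      refine ge_of_tendsto' hlim fun n => ?_
      obtain ⟨k, hk⟩ := h n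
      exact (hmin (TopologicalSpace.denseSeq (Set.Icc 0 a) k).2).trans hk.le
  rw [e]
  exact .iInter fun n => .iUnion fun k => measurableSet_lt (hm _) measurable_const

lemma measurable_sInf_le {Ω : Type*} [MeasurableSpace Ω] {x : ℝ → Ω → ℝ}
    (hm : ∀ t, Measurable (x t)) (hc : ∀ ω, Continuous fun t => x t ω) (u : ℝ) :
    Measurable fun ω => sInf {t : ℝ | 0 ≤ t ∧ x t ω ≤ u} := by
  refine measurable_of_Iic fun a => ?_
  rcases lt_or_ge a 0 with ha | ha
  · convert! MeasurableSet.empty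
    ext ω
    simp only [Set.mem_preimage, Set.mem_Iic, Set.mem_empty_iff_false, iff_false, not_le]
    exact ha.trans_le (Real.sInf_nonneg fun t ht => ht.1)
  · have e : (fun ω => sInf {t : ℝ | 0 ≤ t ∧ x t ω ≤ u}) ⁻¹' Set.Iic a =
        {ω | ∃ t ∈ Set.Icc 0 a, x t ω ≤ u} ∪
          ⋂ n : ℕ, {ω | ∃ t ∈ Set.Icc 0 (n : ℝ), x t ω ≤ u}ᶜ := by
      ext ω
      simp only [Set.mem_preimage, Set.mem_Iic, Set.mem_union, Set.mem_iInter, Set.mem_compl_iff,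
        Set.mem_ofPred_eq]
      rcases Set.eq_empty_or_nonempty {t : ℝ | 0 ≤ t ∧ x t ω ≤ u} with hS | hS
      · rw [hS, Real.sInf_empty]
        refine iff_of_true ha (Or.inr fun n => ?_)
        rintro ⟨t, ht, htu⟩
        have : t ∈ {t : ℝ | 0 ≤ t ∧ x t ω ≤ u} := ⟨ht.1, htu⟩
        simp [hS] at this
      · have hbdd : BddBelow {t : ℝ | 0 ≤ t ∧ x t ω ≤ u} := ⟨0, fun t ht => ht.1⟩
        constructor
        · intro h
          have hcl : IsClosed {t : ℝ | 0 ≤ t ∧ x t ω ≤ u} :=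
            (isClosed_le continuous_const continuous_id).inter
              (isClosed_le (hc ω) continuous_const)
          have := hcl.csInf_mem hS hbdd
          exact Or.inl ⟨_, ⟨this.1, h⟩, this.2⟩
        · rintro (⟨t, ht, htu⟩ | h)
          · exact (csInf_le hbdd ⟨ht.1, htu⟩).trans ht.2
          · obtain ⟨t, ht⟩ := hS
            obtain ⟨n, hn⟩ := exists_nat_ge t
            exact absurd ⟨t, ⟨ht.1, hn⟩, ht.2⟩ (h n)
    rw [e]
    exact (measurableSet_exists_mem_Icc_le hm hc u ha).union (.iInter fun n =>
      (measurableSet_exists_mem_Icc_le hm hc u n.cast_nonneg).compl)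

lemma measurable_excursion_length {Ω : Type*} [MeasurableSpace Ω] {x : ℝ → Ω → ℝ}
    (hm : ∀ t, Measurable (x t)) (hc : ∀ ω, Continuous fun t => x t ω) (u : ℝ) :
    Measurable fun ω => sInf {t : ℝ | 0 ≤ t ∧ x t ω ≤ u} - sSup {t : ℝ | t ≤ 0 ∧ x t ω ≤ u} := by
  refine (measurable_sInf_le hm hc u).sub ?_
  simp_rw [fun ω => sSup_nonpos_eq_neg_sInf (fun t => x t ω) u]
  exact (measurable_sInf_le (x := fun t ω => x (-t) ω) (fun t => hm _)
    (fun ω => (hc ω).comp continuous_neg) u).neg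

/-- If the rescaled path is uniformly close to a downward parabola, then its first passage is
sandwiched between the roots of the lowered and the raised parabola. -/
lemma first_passage_mem_Icc {x : ℝ → ℝ} {u c θ δ η K : ℝ} (hu : 0 < u) (hc : 0 < c) (hδ : 0 ≤ δ)
    (hθ : δ < θ) (hK : (η + √(η ^ 2 + 2 * c * (θ + δ))) / c ≤ K)
    (hx : ∀ t, 0 ≤ t → t ≤ K →
      |u * (x (t / u) - u) - (θ + t * η - c * t ^ 2 / 2)| ≤ δ) :
    u * sInf {t : ℝ | 0 ≤ t ∧ x t ≤ u} ∈
      Set.Icc ((η + √(η ^ 2 + 2 * c * (θ - δ))) / c) ((η + √(η ^ 2 + 2 * c * (θ + δ))) / c) := by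
  set r₁ := √(η ^ 2 + 2 * c * (θ - δ)) with hr₁
  set r₂ := √(η ^ 2 + 2 * c * (θ + δ)) with hr₂
  have hr₁sq : r₁ ^ 2 = η ^ 2 + 2 * c * (θ - δ) := Real.sq_sqrt (by nlinarith [sq_nonneg η])
  have hr₂sq : r₂ ^ 2 = η ^ 2 + 2 * c * (θ + δ) := Real.sq_sqrt (by nlinarith [sq_nonneg η])
  have hr₂η : 0 ≤ η + r₂ := by
    have : |η| ≤ r₂ := Real.abs_le_sqrt (by nlinarith)
    linarith [neg_abs_le η]
  have hr₁η : |η| < r₁ := Real.lt_sqrt_of_sq_lt (by rw [sq_abs]; nlinarith)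
  have hmem : (η + r₂) / c / u ∈ {t : ℝ | 0 ≤ t ∧ x t ≤ u} := by
    refine ⟨by positivity, ?_⟩
    have h := (abs_le.1 (hx ((η + r₂) / c) (by positivity) hK)).2
    have e : θ + (η + r₂) / c * η - c * ((η + r₂) / c) ^ 2 / 2 = -δ := by
      field_simp
      nlinarith
    rw [e] at h
    by_contra hcon
    push Not at hcon
    have := mul_pos hu (sub_pos.2 hcon)
    linarith
  have hbdd : BddBelow {t : ℝ | 0 ≤ t ∧ x t ≤ u} := ⟨0, fun t ht => ht.1⟩
  constructor
  · rw [← div_le_iff₀' hu]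
    refine le_csInf ⟨_, hmem⟩ fun t ht => ?_
    by_contra hcon
    push Not at hcon
    rw [lt_div_iff₀ hu, lt_div_iff₀ hc] at hcon
    have hr : r₁ ≤ r₂ := Real.sqrt_le_sqrt (by nlinarith)
    have h := (abs_le.1 (hx (t * u) (mul_nonneg ht.1 hu.le) (le_trans (by
      rw [le_div_iff₀ hc]; linarith) hK))).1
    rw [mul_div_cancel_right₀ _ hu.ne'] at h
    have h3 : 0 < c * (θ + t * u * η - c * (t * u) ^ 2 / 2 - δ) := by
      have h0 : 0 ≤ t * u * c := mul_nonneg (mul_nonneg ht.1 hu.le) hc.le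
      have : 0 < (r₁ - (t * u * c - η)) * (r₁ + (t * u * c - η)) := by
        apply mul_pos
        · linarith
        · linarith [le_abs_self η]
      nlinarith
    have h4 := (mul_pos_iff_of_pos_left hc).1 h3
    have := mul_nonneg hu.le (sub_nonneg.2 ht.2)
    linarith
  · rw [← le_div_iff₀' hu]
    exact csInf_le hbdd hmem

lemma sqrt_add_le_sqrt_add_sqrt {a b : ℝ} (ha : 0 ≤ a) (hb : 0 ≤ b) : √(a + b) ≤ √a + √b := by
  rw [Real.sqrt_le_left (by positivity), add_sq, Real.sq_sqrt ha, Real.sq_sqrt hb]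
  nlinarith [mul_nonneg (Real.sqrt_nonneg a) (Real.sqrt_nonneg b)]

lemma abs_excursion_length_sub_le {x : ℝ → ℝ} {u c θ δ η K : ℝ} (hu : 0 < u) (hc : 0 < c)
    (hδ : 0 ≤ δ) (hθ : δ < θ) (hK : (|η| + √(η ^ 2 + 2 * c * (θ + δ))) / c ≤ K)
    (hx : ∀ t, |t| ≤ K → |u * (x (t / u) - u) - (θ + t * η - c * t ^ 2 / 2)| ≤ δ) :
    |u * (sInf {t : ℝ | 0 ≤ t ∧ x t ≤ u} - sSup {t : ℝ | t ≤ 0 ∧ x t ≤ u})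
      - 2 / c * √(η ^ 2 + 2 * c * θ)| ≤ 2 / c * √(2 * c * δ) := by
  have h1 := first_passage_mem_Icc (x := x) (η := η) hu hc hδ hθ
    (le_trans (by gcongr; exact le_abs_self η) hK)
    fun t ht htK => hx t (by rwa [abs_of_nonneg ht])
  have h2 := first_passage_mem_Icc (x := fun t => x (-t)) (η := -η) hu hc hδ hθ
    (le_trans (by rw [neg_sq]; gcongr; exact neg_le_abs η) hK)
    fun t ht htK => by
      have := hx (-t) (by rwa [abs_neg, abs_of_nonneg ht])
      rw [neg_div, neg_sq, neg_mul] at this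
      rwa [mul_neg]
  rw [sSup_nonpos_eq_neg_sInf]
  rw [neg_sq] at h2
  have hs1 : √(η ^ 2 + 2 * c * (θ + δ)) ≤ √(η ^ 2 + 2 * c * θ) + √(2 * c * δ) := by
    rw [show η ^ 2 + 2 * c * (θ + δ) = (η ^ 2 + 2 * c * θ) + 2 * c * δ by ring]
    exact sqrt_add_le_sqrt_add_sqrt (by nlinarith [sq_nonneg η]) (by positivity)
  have hs2 : √(η ^ 2 + 2 * c * θ) ≤ √(η ^ 2 + 2 * c * (θ - δ)) + √(2 * c * δ) := by
    rw [show η ^ 2 + 2 * c * θ = (η ^ 2 + 2 * c * (θ - δ)) + 2 * c * δ by ring]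
    exact sqrt_add_le_sqrt_add_sqrt (by nlinarith [sq_nonneg η]) (by positivity)
  obtain ⟨h1a, h1b⟩ := h1
  obtain ⟨h2a, h2b⟩ := h2
  rw [div_le_iff₀ hc] at h1a h2a
  rw [le_div_iff₀ hc] at h1b h2b
  rw [show u * (sInf {t : ℝ | 0 ≤ t ∧ x t ≤ u} - -sInf {t : ℝ | 0 ≤ t ∧ x (-t) ≤ u})
      - 2 / c * √(η ^ 2 + 2 * c * θ) = (u * sInf {t : ℝ | 0 ≤ t ∧ x t ≤ u} * c
        + u * sInf {t : ℝ | 0 ≤ t ∧ x (-t) ≤ u} * c - 2 * √(η ^ 2 + 2 * c * θ)) / c by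
      field_simp; ring, abs_div, abs_of_pos hc, div_mul_eq_mul_div,
    div_le_div_iff_of_pos_right hc, abs_le]
  constructor <;> linarith

end Hitting

section Overshoot

lemma integral_expMeasure_one (g : ℝ → ℝ) :
    ∫ s, g s ∂(expMeasure 1) = ∫ s in Set.Ioi 0, Real.exp (-s) * g s := by
  have h : expMeasure 1 = volume.withDensity (exponentialPDF 1) := rfl
  rw [h, integral_withDensity_eq_integral_toReal_smul
    (show Measurable (exponentialPDF 1) from (measurable_exponentialPDFReal 1).ennreal_ofReal)
    (.of_forall fun s => ENNReal.ofReal_lt_top),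
    ← integral_Ici_eq_integral_Ioi, ← integral_indicator measurableSet_Ici]
  congr 1 with s
  rw [exponentialPDF_eq, ENNReal.toReal_ofReal (by split_ifs <;> positivity)]
  by_cases hs : 0 ≤ s
  · simp [hs]
  · simp [hs]

/-- The Gaussian density seen from a high level `u`, in the scale of the overshoot. -/
lemma setIntegral_Ioi_gaussianReal {v : NNReal} (hv : v ≠ 0) {u : ℝ} (hu : 0 < u) (h : ℝ → ℝ) :
    ∫ x in Set.Ioi u, h (u * (x - u) / v) ∂(gaussianReal 0 v) =
      v / u * gaussianPDFReal 0 v u *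
        ∫ s in Set.Ioi 0, Real.exp (-s - v * s ^ 2 / (2 * u ^ 2)) * h s := by
  have hv' : (0 : ℝ) < v := lt_of_le_of_ne v.2 (by exact_mod_cast hv.symm)
  rw [← integral_indicator measurableSet_Ioi, integral_gaussianReal_eq_integral_smul hv,
    ← integral_indicator measurableSet_Ioi, ← integral_add_left_eq_self _ u]
  have h1 := Measure.integral_comp_mul_left (fun y => gaussianPDFReal 0 v (u + y) •
    (Set.Ioi u).indicator (fun x => h (u * (x - u) / v)) (u + y)) (v / u)
  rw [abs_of_pos (by positivity), smul_eq_mul, eq_inv_mul_iff_mul_eq₀ (by positivity)] at h1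
  rw [← h1, mul_assoc, ← integral_const_mul (gaussianPDFReal 0 v u)]
  congr 2 with s
  by_cases hs : 0 < s
  · rw [Set.indicator_of_mem (by simp; positivity), Set.indicator_of_mem (Set.mem_Ioi.2 hs),
      smul_eq_mul,
      ← mul_assoc]
    congr 1
    · simp only [gaussianPDFReal_def]
      rw [mul_assoc _ (Real.exp _), ← Real.exp_add]
      congr 2
      field_simp
      ring
    · congr 1; field_simp; ring
  · have : ¬ u < u + v / u * s := by
      push Not at hs ⊢
      nlinarith [mul_nonpos_of_nonneg_of_nonpos (show (0 : ℝ) ≤ v / u by positivity) hs]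
    rw [Set.indicator_of_notMem (by simpa using this), Set.indicator_of_notMem (by simpa using hs)]
    simp

lemma tendsto_setIntegral_exp_mul (v : ℝ) (hv : 0 ≤ v) {h : ℝ → ℝ → ℝ} {g : ℝ → ℝ} {C : ℝ}
    (hm : ∀ u, Measurable (h u)) (hC : ∀ u s, |h u s| ≤ C)
    (hlim : ∀ s > 0, Tendsto (fun u => h u s) atTop (𝓝 (g s))) :
    Tendsto (fun u => ∫ s in Set.Ioi 0, Real.exp (-s - v * s ^ 2 / (2 * u ^ 2)) * h u s) atTop
      (𝓝 (∫ s in Set.Ioi 0, Real.exp (-s) * g s)) := by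
  refine tendsto_integral_filter_of_dominated_convergence (fun s => Real.exp (-s) * C)
    (.of_forall fun u => ?_) (.of_forall fun u => .of_forall fun s => ?_)
    ((integrableOn_exp_neg_Ioi 0).mul_const C) ?_
  · have := hm u
    fun_prop
  · rw [norm_mul, Real.norm_eq_abs, Real.norm_eq_abs, Real.abs_exp]
    have : 0 ≤ v * s ^ 2 / (2 * u ^ 2) := by positivity
    gcongr
    · linarith
    · exact hC u s
  · refine (ae_restrict_mem measurableSet_Ioi).mono fun s hs => ?_
    refine Tendsto.mul ((Real.continuous_exp.tendsto _).comp ?_) (hlim s hs)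
    have : Tendsto (fun u : ℝ => v * s ^ 2 / (2 * u ^ 2)) atTop (𝓝 0) :=
      tendsto_const_nhds.div_atTop ((tendsto_pow_atTop two_ne_zero).const_mul_atTop two_pos)
    simpa using tendsto_const_nhds.sub this

/-- The rescaled overshoot of a Gaussian variable above a high level is asymptotically
exponential. -/
lemma tendsto_setIntegral_overshoot {v : NNReal} (hv : v ≠ 0) {h : ℝ → ℝ → ℝ} {g : ℝ → ℝ} {C : ℝ}
    (hm : ∀ u, Measurable (h u)) (hC : ∀ u s, |h u s| ≤ C)
    (hlim : ∀ s > 0, Tendsto (fun u => h u s) atTop (𝓝 (g s))) :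
    Tendsto (fun u => ((gaussianReal 0 v).real (Set.Ioi u))⁻¹ *
        ∫ x in Set.Ioi u, h u (u * (x - u) / v) ∂(gaussianReal 0 v)) atTop
      (𝓝 (∫ s, g s ∂(expMeasure 1))) := by
  have h1 := tendsto_setIntegral_exp_mul v v.2 hm hC hlim
  have h2 := tendsto_setIntegral_exp_mul v v.2 (h := fun _ _ => 1) (g := fun _ => 1) (C := 1)
    (fun _ => measurable_const) (by simp) (fun _ _ => tendsto_const_nhds)
  have h3 : ∫ s in Set.Ioi (0 : ℝ), Real.exp (-s) * 1 = 1 := by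
    simp [integral_exp_Iic]
  rw [h3] at h2
  have h4 := (h2.inv₀ one_ne_zero).mul h1
  rw [inv_one, one_mul, ← integral_expMeasure_one] at h4
  refine h4.congr' ?_
  filter_upwards [eventually_gt_atTop 0] with u hu
  have e := setIntegral_Ioi_gaussianReal hv hu (fun _ => 1)
  rw [setIntegral_const, smul_eq_mul, mul_one] at e
  rw [e, setIntegral_Ioi_gaussianReal hv hu]
  have hp := gaussianPDFReal_pos 0 v u hv
  have hv' : (0 : ℝ) < v := lt_of_le_of_ne v.2 (by exact_mod_cast hv.symm)
  have hne : (v : ℝ) / u * gaussianPDFReal 0 v u ≠ 0 := by positivity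
  rw [mul_inv, mul_mul_mul_comm, inv_mul_cancel₀ hne, one_mul]

variable {Ω : Type*} [MeasurableSpace Ω] {P : Measure Ω} {ξ : Ω → ℝ}

lemma measure_lt_ne_zero_of_map_eq_gaussianReal {v : NNReal} (hv : v ≠ 0) (hξ : Measurable ξ)
    (hlaw : P.map ξ = gaussianReal 0 v) (u : ℝ) : P {ω | u < ξ ω} ≠ 0 := by
  rw [show {ω | u < ξ ω} = ξ ⁻¹' Set.Ioi u from rfl, ← Measure.map_apply hξ measurableSet_Ioi,
    hlaw]
  intro h
  have := (gaussianReal_absolutelyContinuous' 0 hv) h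
  simp at this

variable [IsProbabilityMeasure P]

lemma integral_cond_overshoot {v : NNReal} (hξ : Measurable ξ)
    (hlaw : P.map ξ = gaussianReal 0 v) {η : Ω → ℝ} (hη : Measurable η) (hind : IndepFun η ξ P)
    {φ : ℝ × ℝ → ℝ} (hφ : Measurable φ) {C : ℝ} (hC : ∀ p, |φ p| ≤ C) (u : ℝ) :
    ∫ ω, φ (η ω, u * (ξ ω - u) / v) ∂(P[|{ω | u < ξ ω}]) =
      ((gaussianReal 0 v).real (Set.Ioi u))⁻¹ *
        ∫ x in Set.Ioi u, (fun s => ∫ y, φ (y, s) ∂(P.map η)) (u * (x - u) / v)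
          ∂(gaussianReal 0 v) := by
  have hA : MeasurableSet {ω | u < ξ ω} := measurableSet_lt measurable_const hξ
  have : IsProbabilityMeasure (P.map η) := Measure.isProbabilityMeasure_map hη.aemeasurable
  rw [ProbabilityTheory.cond, integral_smul_measure, smul_eq_mul, ENNReal.toReal_inv]
  have e1 : (P {ω | u < ξ ω}).toReal = (gaussianReal 0 v).real (Set.Ioi u) := by
    rw [← hlaw, map_measureReal_apply hξ measurableSet_Ioi]; rfl
  rw [e1]
  congr 1
  set ψ : ℝ × ℝ → ℝ := fun p => (Set.Ioi u).indicator (fun x => φ (p.1, u * (x - u) / v)) p.2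
    with hψdef
  have hψ : Measurable ψ :=
    (hφ.comp (show Measurable fun p : ℝ × ℝ => (p.1, u * (p.2 - u) / v) by fun_prop)).indicator
      (measurable_snd measurableSet_Ioi)
  have hψint : Integrable ψ ((P.map η).prod (gaussianReal 0 v)) := by
    refine .of_bound hψ.aestronglyMeasurable C (.of_forall fun p => ?_)
    have hC0 : 0 ≤ C := (abs_nonneg _).trans (hC (0, 0))
    simp only [hψdef, Set.indicator]
    split_ifs
    · exact hC _
    · simpa using hC0
  have hjoint : P.map (fun ω => (η ω, ξ ω)) = (P.map η).prod (gaussianReal 0 v) := by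
    rw [← hlaw]
    exact (indepFun_iff_map_prod_eq_prod_map_map hη.aemeasurable hξ.aemeasurable).1 hind
  calc ∫ ω in {ω | u < ξ ω}, φ (η ω, u * (ξ ω - u) / v) ∂P
      = ∫ ω, ψ (η ω, ξ ω) ∂P := by
        rw [← integral_indicator hA]; rfl
    _ = ∫ p, ψ p ∂((P.map η).prod (gaussianReal 0 v)) := by
        rw [← hjoint, integral_map (hη.prodMk hξ).aemeasurable hψ.aestronglyMeasurable]
    _ = ∫ x, ∫ y, ψ (y, x) ∂(P.map η) ∂(gaussianReal 0 v) := integral_prod_symm _ hψint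
    _ = _ := by
        rw [← integral_indicator measurableSet_Ioi]
        congr 1 with x
        by_cases hx : x ∈ Set.Ioi u <;> simp [hψdef, hx]

lemma tendsto_integral_cond_overshoot {v : NNReal} (hv : v ≠ 0) (hξ : Measurable ξ)
    (hlaw : P.map ξ = gaussianReal 0 v) {h : ℝ → ℝ} (hm : Measurable h) {C : ℝ}
    (hC : ∀ s, |h s| ≤ C) :
    Tendsto (fun u => ∫ ω, h (u * (ξ ω - u) / v) ∂(P[|{ω | u < ξ ω}])) atTop
      (𝓝 (∫ s, h s ∂(expMeasure 1))) := by
  refine (tendsto_setIntegral_overshoot hv (fun _ => hm) (fun _ => hC)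
    fun _ _ => tendsto_const_nhds).congr fun u => ?_
  have := integral_cond_overshoot hξ hlaw (measurable_const (a := (0 : ℝ)))
    (indepFun_const_left 0 ξ) (φ := fun p => h p.2) (by fun_prop) (fun p => hC p.2) u
  simpa using this.symm

/-- Joint limit law of the rescaled overshoot and an independent centered Gaussian variable whose
variance converges. -/
lemma tendsto_integral_cond_overshoot_prod {v : NNReal} (hv : v ≠ 0) (hξ : Measurable ξ)
    (hlaw : P.map ξ = gaussianReal 0 v) {η : ℝ → Ω → ℝ} (hη : ∀ u, Measurable (η u))
    (hind : ∀ u, IndepFun (η u) ξ P) {w : ℝ → NNReal}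
    (hηlaw : ∀ u, P.map (η u) = gaussianReal 0 (w u)) {l : ℝ}
    (hw : Tendsto (fun u => √(w u)) atTop (𝓝 l)) {φ : ℝ × ℝ → ℝ} (hφ : Continuous φ) {C : ℝ}
    (hC : ∀ p, |φ p| ≤ C) :
    Tendsto (fun u => ∫ ω, φ (η u ω, u * (ξ ω - u) / v) ∂(P[|{ω | u < ξ ω}])) atTop
      (𝓝 (∫ s, ∫ z, φ (l * z, s) ∂(gaussianReal 0 1) ∂(expMeasure 1))) := by
  have key : ∀ u s, ∫ y, φ (y, s) ∂(P.map (η u)) = ∫ z, φ (√(w u) * z, s) ∂(gaussianReal 0 1) := by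
    intro u s
    have : gaussianReal 0 (w u) = (gaussianReal 0 1).map (√(w u) * ·) := by
      rw [gaussianReal_map_const_mul, mul_zero, mul_one]
      congr 1
      exact NNReal.coe_injective (by simp [Real.sq_sqrt])
    rw [hηlaw, this, integral_map (by fun_prop) (by fun_prop)]
  refine Tendsto.congr (fun u =>
    (integral_cond_overshoot hξ hlaw (hη u) (hind u) hφ.measurable hC u).symm) ?_
  simp_rw [key]
  refine tendsto_setIntegral_overshoot hv
    (h := fun u s => ∫ z, φ (√(w u) * z, s) ∂(gaussianReal 0 1)) (C := C) (fun u => ?_)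
    (fun u s => ?_) fun s _ => ?_
  · exact StronglyMeasurable.measurable
      (StronglyMeasurable.integral_prod_right (f := fun s z => φ (√(w u) * z, s))
        (Continuous.stronglyMeasurable (by fun_prop)))
  · simpa using norm_integral_le_of_norm_le_const (μ := gaussianReal 0 1)
      (f := fun z => φ (√(w u) * z, s)) (.of_forall fun z => hC (√(w u) * z, s))
  · refine tendsto_integral_filter_of_dominated_convergence (fun _ => C)
      (.of_forall fun u => (Continuous.aestronglyMeasurable (by fun_prop)))
      (.of_forall fun u => .of_forall fun z => hC _) (integrable_const C) (.of_forall fun z => ?_)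
    exact (hφ.tendsto (l * z, s)).comp ((hw.mul_const z).prodMk_nhds tendsto_const_nhds)

end Overshoot

section Increments

/-- Second-order control of the increments of a rescaled smooth function, uniform in the scale. -/
lemma abs_rescaled_increment_sub_le {f f' : ℝ → ℝ} (hf : ∀ y, HasDerivAt f (f' y) y)
    (hb : ∀ y, |f' y| ≤ 1) (hL : ∀ y z, |f' y - f' z| ≤ |y - z|) {u K : ℝ} (hu : 0 < u)
    (hK : 1 ≤ K) (x : ℝ) {s t : ℝ} (hs : |s| ≤ K) (ht : |t| ≤ K) :
    |u * (f (t / u * x) - f (s / u * x)) - (t - s) * (u * (f (1 / u * x) - f 0))| ≤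
      2 * |t - s| * (|x| * min 2 (K * |x| / u)) := by
  set B := |x| * min 2 (K * |x| / u) with hB
  have key : ∀ s t, |s| ≤ K → |t| ≤ K →
      |(u * f (t / u * x) - t * (x * f' 0)) - (u * f (s / u * x) - s * (x * f' 0))| ≤
        B * |t - s| := by
    intro s t hs ht
    have hd : ∀ τ ∈ Set.Icc (-K) K, HasDerivWithinAt
        (fun τ => u * f (τ / u * x) - τ * (x * f' 0)) (x * (f' (τ / u * x) - f' 0))
        (Set.Icc (-K) K) τ := by
      intro τ _
      have h1 := ((hf (τ / u * x)).comp τ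
        (((hasDerivAt_id τ).div_const u).mul_const x)).const_mul u
      have h2 := (hasDerivAt_id τ).mul_const (x * f' 0)
      refine HasDerivAt.hasDerivWithinAt ?_
      convert! h1.sub h2 using 1
      field_simp
    refine Convex.norm_image_sub_le_of_norm_hasDerivWithin_le hd (fun τ hτ => ?_)
      (convex_Icc _ _) (abs_le.1 hs) (abs_le.1 ht)
    rw [Real.norm_eq_abs, abs_mul]
    refine mul_le_mul_of_nonneg_left (le_min ?_ ?_) (abs_nonneg x)
    · calc |f' (τ / u * x) - f' 0| ≤ |f' (τ / u * x)| + |f' 0| := abs_sub _ _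
        _ ≤ 2 := by linarith [hb (τ / u * x), hb 0]
    · refine (hL _ _).trans ?_
      rw [sub_zero, abs_mul, abs_div, abs_of_pos hu, div_mul_eq_mul_div]
      gcongr
      exact abs_le.2 hτ
  have h1 := key s t hs ht
  have h2 := key 0 1 (by simp; linarith) (by simpa using hK)
  simp only [zero_div, zero_mul, sub_zero, abs_one, mul_one, one_mul] at h2
  calc _ = |((u * f (t / u * x) - t * (x * f' 0)) - (u * f (s / u * x) - s * (x * f' 0)))
        - (t - s) * (u * f (1 / u * x) - x * f' 0 - u * f 0)| := by congr 1; ring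
    _ ≤ B * |t - s| + |t - s| * B := by
        refine (abs_sub _ _).trans (add_le_add h1 ?_)
        rw [abs_mul]
        exact mul_le_mul_of_nonneg_left h2 (abs_nonneg _)
    _ = _ := by ring

lemma tendsto_integral_sq_mul_min {μ : Measure ℝ} (hm : Integrable (fun x : ℝ => x ^ 2) μ)
    (K : ℝ) (hK : 0 ≤ K) :
    Tendsto (fun u => ∫ x, (|x| * min 2 (K * |x| / u)) ^ 2 ∂μ) atTop (𝓝 0) := by
  have := tendsto_integral_filter_of_dominated_convergence (μ := μ) (l := atTop)
    (F := fun u x => (|x| * min 2 (K * |x| / u)) ^ 2) (f := fun _ => (0 : ℝ))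
    (fun x => x ^ 2 * 4) (.of_forall fun u => Measurable.aestronglyMeasurable (by fun_prop))
    ?_ (hm.mul_const 4) (.of_forall fun x => ?_)
  · simpa using this
  · filter_upwards [eventually_gt_atTop 0] with u hu
    refine .of_forall fun x => ?_
    have h0 : 0 ≤ min 2 (K * |x| / u) := le_min (by norm_num) (by positivity)
    rw [Real.norm_eq_abs, abs_of_nonneg (by positivity), mul_pow, sq_abs]
    have h2 : min 2 (K * |x| / u) ≤ 2 := min_le_left _ _
    gcongr
    nlinarith
  · have h1 : Tendsto (fun u => K * |x| / u) atTop (𝓝 0) :=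
      tendsto_const_nhds.div_atTop tendsto_id
    have h2 := ((tendsto_const_nhds (x := (2 : ℝ))).min h1).const_mul |x| |>.pow 2
    simpa using h2

lemma tendsto_sq_mul_covariance_sub {R : ℝ → ℝ} {m : ℝ}
    (hR : Tendsto (fun s => (R 0 - R s) / s ^ 2) (𝓝[≠] 0) (𝓝 (m / 2))) :
    Tendsto (fun u => u ^ 2 * (R 0 - R (1 / u))) atTop (𝓝 (m / 2)) := by
  have h : Tendsto (fun u : ℝ => 1 / u) atTop (𝓝[≠] 0) := by
    simp_rw [one_div]
    exact tendsto_inv_atTop_nhdsGT_zero.mono_right (nhdsWithin_mono _ fun x hx => ne_of_gt hx)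
  refine (hR.comp h).congr fun u => ?_
  simp only [Function.comp_apply, one_div, inv_pow, div_inv_eq_mul]
  ring

lemma eventually_forall_abs_rescaled_covariance_le {R : ℝ → ℝ} {m : ℝ}
    (hR : Tendsto (fun s => (R 0 - R s) / s ^ 2) (𝓝[≠] 0) (𝓝 (m / 2))) (K : ℝ) {ε : ℝ}
    (hε : 0 < ε) :
    ∀ᶠ u in atTop, ∀ t, |t| ≤ K → |u ^ 2 * (R 0 - R (t / u)) - m * t ^ 2 / 2| ≤ ε := by
  set ε' := ε / (K ^ 2 + 1) with hε'
  have hε'pos : 0 < ε' := by positivity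
  have h := (Metric.tendsto_nhds.1 hR) ε' hε'pos
  rw [eventually_nhdsWithin_iff, Metric.eventually_nhds_iff] at h
  obtain ⟨ρ, hρ, h⟩ := h
  filter_upwards [eventually_gt_atTop 0, eventually_gt_atTop (K / ρ)] with u hu huρ t ht
  rcases eq_or_ne t 0 with rfl | ht0
  · simp [hε.le]
  have hlt : dist (t / u) 0 < ρ := by
    rw [Real.dist_eq, sub_zero, abs_div, abs_of_pos hu, div_lt_iff₀ hu]
    rw [div_lt_iff₀ hρ] at huρ
    linarith
  have h3 := h hlt (div_ne_zero ht0 hu.ne')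
  rw [Real.dist_eq] at h3
  have e : u ^ 2 * (R 0 - R (t / u)) - m * t ^ 2 / 2 =
      t ^ 2 * ((R 0 - R (t / u)) / (t / u) ^ 2 - m / 2) := by
    field_simp
  rw [e, abs_mul, abs_of_nonneg (sq_nonneg t)]
  have ht2 : t ^ 2 ≤ K ^ 2 := by rw [← sq_abs t]; gcongr
  calc t ^ 2 * |(R 0 - R (t / u)) / (t / u) ^ 2 - m / 2| ≤ (K ^ 2 + 1) * ε' := by
        gcongr; linarith
    _ = ε := by rw [hε']; field_simp

end Increments

section Residual

variable {Ω : Type*}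

/-- The fluctuation of the process near the origin, at scale `1 / u`, after removal of its
regression on the value at the origin. -/
noncomputable def rescaledResidual (X : ℝ → Ω → ℝ) (R : ℝ → ℝ) (u t : ℝ) (ω : Ω) : ℝ :=
  u * (X (t / u) ω - R (t / u) / R 0 * X 0 ω)

/-- The deviation of the rescaled residual from the line through its values at `0` and `1`. -/
noncomputable def residualDeviation (X : ℝ → Ω → ℝ) (R : ℝ → ℝ) (u t : ℝ) (ω : Ω) : ℝ :=
  rescaledResidual X R u t ω - t * rescaledResidual X R u 1 ω

lemma rescaledResidual_mem_span (X : ℝ → Ω → ℝ) (R : ℝ → ℝ) (u t : ℝ) :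
    rescaledResidual X R u t ∈ Submodule.span ℝ (Set.range X) := by
  have : rescaledResidual X R u t = u • (X (t / u) - (R (t / u) / R 0) • X 0) := by
    ext ω; simp [rescaledResidual]
  rw [this]
  have hmem : ∀ s, X s ∈ Submodule.span ℝ (Set.range X) := fun s =>
    Submodule.subset_span ⟨s, rfl⟩
  exact Submodule.smul_mem _ _ (sub_mem (hmem _) (Submodule.smul_mem _ _ (hmem _)))

lemma residualDeviation_mem_span (X : ℝ → Ω → ℝ) (R : ℝ → ℝ) (u t : ℝ) :
    residualDeviation X R u t ∈ Submodule.span ℝ (Set.range X) :=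
  sub_mem (rescaledResidual_mem_span X R u t)
    (Submodule.smul_mem _ t (rescaledResidual_mem_span X R u 1))

lemma residualDeviation_zero (X : ℝ → Ω → ℝ) {R : ℝ → ℝ} (hR0 : R 0 ≠ 0) (u : ℝ) (ω : Ω) :
    residualDeviation X R u 0 ω = 0 := by
  simp [residualDeviation, rescaledResidual, hR0]

variable [MeasurableSpace Ω] {P : Measure Ω} {X : ℝ → Ω → ℝ} {R : ℝ → ℝ}

namespace IsZeroMeanGaussianProcess

lemma integral_rescaledResidual_mul (hX : IsZeroMeanGaussianProcess P X)
    (hcov : ∀ s t, ∫ ω, X s ω * X t ω ∂P = R (s - t)) (hR0 : R 0 ≠ 0) (u t : ℝ) :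
    ∫ ω, rescaledResidual X R u t ω * X 0 ω ∂P = 0 := by
  have hmem : ∀ s, X s ∈ Submodule.span ℝ (Set.range X) := fun s =>
    Submodule.subset_span ⟨s, rfl⟩
  have e : ∀ ω, rescaledResidual X R u t ω * X 0 ω =
      u * (X (t / u) ω * X 0 ω - R (t / u) / R 0 * (X 0 ω * X 0 ω)) := fun ω => by
    simp only [rescaledResidual]; ring
  simp_rw [e]
  rw [integral_const_mul, integral_sub (hX.integrable_mul (hmem _) (hmem _))
    ((hX.integrable_mul (hmem _) (hmem _)).const_mul _), integral_const_mul, hcov, hcov]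
  simp [hR0]

lemma integral_residualDeviation_sub_mul (hX : IsZeroMeanGaussianProcess P X)
    (hcov : ∀ s t, ∫ ω, X s ω * X t ω ∂P = R (s - t)) (hR0 : R 0 ≠ 0) (u s t : ℝ) :
    ∫ ω, (residualDeviation X R u t - residualDeviation X R u s) ω * X 0 ω ∂P = 0 := by
  have hmem : X 0 ∈ Submodule.span ℝ (Set.range X) := Submodule.subset_span ⟨0, rfl⟩
  have hi : ∀ t, Integrable (fun ω => rescaledResidual X R u t ω * X 0 ω) P := fun t =>
    hX.integrable_mul (rescaledResidual_mem_span X R u t) hmem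
  have e : ∀ ω, (residualDeviation X R u t - residualDeviation X R u s) ω * X 0 ω =
      rescaledResidual X R u t ω * X 0 ω - rescaledResidual X R u s ω * X 0 ω
        - (t - s) * (rescaledResidual X R u 1 ω * X 0 ω) := fun ω => by
    simp only [residualDeviation, Pi.sub_apply]; ring
  simp_rw [e]
  have hi2 : Integrable (fun ω => rescaledResidual X R u t ω * X 0 ω
      - rescaledResidual X R u s ω * X 0 ω) P := (hi t).sub (hi s)
  rw [integral_sub hi2 ((hi 1).const_mul _), integral_sub (hi t) (hi s),
    integral_const_mul]
  simp [hX.integral_rescaledResidual_mul hcov hR0]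

lemma integral_rescaledResidual_one_sq (hX : IsZeroMeanGaussianProcess P X)
    (hcov : ∀ s t, ∫ ω, X s ω * X t ω ∂P = R (s - t)) (hR0 : R 0 ≠ 0) (u : ℝ) :
    ∫ ω, rescaledResidual X R u 1 ω ^ 2 ∂P =
      u ^ 2 * (R 0 - R (1 / u)) * ((R 0 + R (1 / u)) / R 0) := by
  have hmem : ∀ s, X s ∈ Submodule.span ℝ (Set.range X) := fun s =>
    Submodule.subset_span ⟨s, rfl⟩
  have hi := hX.integrable_mul (hmem (1 / u)) (hmem (1 / u))
  have hi' := hX.integrable_mul (rescaledResidual_mem_span X R u 1) (hmem 0)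
  have hi'' := hX.integrable_mul (hmem (1 / u)) (hmem 0)
  have e : ∀ ω, rescaledResidual X R u 1 ω ^ 2 =
      u ^ 2 * (X (1 / u) ω * X (1 / u) ω - R (1 / u) / R 0 * (X (1 / u) ω * X 0 ω))
        - u * (R (1 / u) / R 0) * (rescaledResidual X R u 1 ω * X 0 ω) := fun ω => by
    simp only [rescaledResidual]; ring
  have hi2 : Integrable (fun ω => u ^ 2 *
      (X (1 / u) ω * X (1 / u) ω - R (1 / u) / R 0 * (X (1 / u) ω * X 0 ω))) P :=
    (hi.sub (hi''.const_mul _)).const_mul _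
  simp_rw [e]
  rw [integral_sub hi2 (hi'.const_mul _), integral_const_mul, integral_const_mul,
    integral_sub hi (hi''.const_mul _), integral_const_mul,
    hX.integral_rescaledResidual_mul hcov hR0, hcov, hcov]
  simp
  field_simp
  ring

lemma integral_residualDeviation_sub_sq_le (hX : IsZeroMeanGaussianProcess P X)
    {μ : Measure ℝ} [IsFiniteMeasure μ] (hm : Integrable (fun x : ℝ => x ^ 2) μ)
    (hcov : ∀ s t, ∫ ω, X s ω * X t ω ∂P = R (s - t))
    (hR : ∀ t, R t = ∫ x, Real.cos (t * x) ∂μ) (hR0 : R 0 ≠ 0) {u K : ℝ} (hu : 0 < u)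
    (hK : 1 ≤ K) {s t : ℝ} (hs : |s| ≤ K) (ht : |t| ≤ K) :
    ∫ ω, (residualDeviation X R u t - residualDeviation X R u s) ω ^ 2 ∂P ≤
      8 * (∫ x, (|x| * min 2 (K * |x| / u)) ^ 2 ∂μ) * (t - s) ^ 2 := by
  have hmem : X 0 ∈ Submodule.span ℝ (Set.range X) := Submodule.subset_span ⟨0, rfl⟩
  set c : Fin 4 → ℝ := ![u, -u, -((t - s) * u), (t - s) * u] with hc
  set τ : Fin 4 → ℝ := ![t / u, s / u, 1 / u, 0] with hτ
  refine (hX.integral_sq_le (sub_mem (residualDeviation_mem_span X R u t)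
    (residualDeviation_mem_span X R u s)) hmem
    (hX.integral_residualDeviation_sub_mul hcov hR0 u s t)
    (u * (R (t / u) / R 0 - R (s / u) / R 0) - (t - s) * u * (R (1 / u) / R 0 - 1))
    (A := fun ω => ∑ i, c i * X (τ i) ω) fun ω => ?_).trans ?_
  · simp [Fin.sum_univ_four, hc, hτ, residualDeviation, rescaledResidual]
    ring
  · rw [hX.integral_sum_sq (fun s t => by rw [hcov, hR]), mul_right_comm, ← integral_const_mul]
    have hint : Integrable (fun x => 8 * (t - s) ^ 2 * (|x| * min 2 (K * |x| / u)) ^ 2) μ := by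
      refine Integrable.const_mul ((hm.mul_const 4).mono'
        (Measurable.aestronglyMeasurable (by fun_prop)) (.of_forall fun x => ?_)) _
      have h0 : 0 ≤ min 2 (K * |x| / u) := le_min (by norm_num) (by positivity)
      rw [Real.norm_eq_abs, abs_of_nonneg (by positivity), mul_pow, sq_abs]
      have h2 : min 2 (K * |x| / u) ≤ 2 := min_le_left _ _
      gcongr
      nlinarith
    refine integral_mono_of_nonneg (.of_forall fun x => by positivity) hint
      (.of_forall fun x => ?_)
    have hcos := abs_rescaled_increment_sub_le (f := Real.cos) (f' := fun y => -Real.sin y)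
      Real.hasDerivAt_cos (fun y => by rw [abs_neg]; exact Real.abs_sin_le_one y)
      (fun y z => by
        rw [← abs_neg]
        simpa [neg_add_eq_sub] using Real.abs_sin_sub_sin_le y z) hu hK x hs ht
    have hsin := abs_rescaled_increment_sub_le (f := Real.sin) (f' := Real.cos)
      Real.hasDerivAt_sin Real.abs_cos_le_one
      (fun y z => by simpa using Real.abs_cos_sub_cos_le y z) hu hK x hs ht
    have hcos2 := sq_le_sq' (abs_le.1 hcos).1 (abs_le.1 hcos).2
    have hsin2 := sq_le_sq' (abs_le.1 hsin).1 (abs_le.1 hsin).2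
    simp only [mul_pow, sq_abs] at hcos2 hsin2 ⊢
    simp only [Fin.sum_univ_four, hc, hτ, Matrix.cons_val]
    rw [Real.cos_zero] at hcos2
    rw [Real.sin_zero] at hsin2
    rw [zero_mul, Real.cos_zero, Real.sin_zero]
    linarith

end IsZeroMeanGaussianProcess

end Residual

section Closeness

variable {Ω : Type*} [MeasurableSpace Ω]

lemma tendsto_integral_sub_of_eventually_close {Q : ℝ → Measure Ω}
    [∀ u, IsProbabilityMeasure (Q u)] {a b : ℝ → Ω → ℝ} (ha : ∀ u, Measurable (a u))
    (hb : ∀ u, Measurable (b u))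
    (h : ∀ ε > 0, ∃ B, ∀ δ > 0, ∀ᶠ u in atTop,
      Q u {ω | B < |b u ω| ∨ δ < |a u ω - b u ω|} ≤ ENNReal.ofReal ε)
    (f : BoundedContinuousFunction ℝ ℝ) :
    Tendsto (fun u => ∫ ω, f (a u ω) ∂Q u - ∫ ω, f (b u ω) ∂Q u) atTop (𝓝 0) := by
  refine Metric.tendsto_nhds.2 fun ε hε => ?_
  set ε₀ := ε / (2 * ‖f‖ + 2) with hε₀
  have hf := norm_nonneg f
  have hε₀pos : 0 < ε₀ := by positivity
  obtain ⟨B, hB⟩ := h ε₀ hε₀pos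
  obtain ⟨ρ, hρ, hunif⟩ := Metric.uniformContinuousOn_iff.1
    ((isCompact_Icc (a := -(B + 1)) (b := B + 1)).uniformContinuousOn_of_continuous
      f.continuous.continuousOn) ε₀ hε₀pos
  have hδ : 0 < min (ρ / 2) 1 := by positivity
  filter_upwards [hB _ hδ] with u hu
  set S := {ω | B < |b u ω| ∨ min (ρ / 2) 1 < |a u ω - b u ω|} with hS
  have ha' := ha u
  have hb' := hb u
  have hSm : MeasurableSet S :=
    MeasurableSet.union (measurableSet_lt measurable_const hb'.abs)
      (measurableSet_lt measurable_const (ha'.sub hb').abs)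
  have hfi : ∀ {g : Ω → ℝ}, Measurable g → Integrable (fun ω => f (g ω)) (Q u) := fun hg =>
    .of_bound (f.continuous.measurable.comp hg).aestronglyMeasurable ‖f‖
      (.of_forall fun ω => f.norm_coe_le_norm _)
  have hpt : ∀ ω, ‖f (a u ω) - f (b u ω)‖ ≤ ε₀ + S.indicator (fun _ => 2 * ‖f‖) ω := by
    intro ω
    by_cases hω : ω ∈ S
    · rw [Set.indicator_of_mem hω, ← dist_eq_norm]
      linarith [f.dist_le_two_norm (a u ω) (b u ω)]
    · rw [Set.indicator_of_notMem hω, add_zero, ← dist_eq_norm]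
      simp only [hS, Set.mem_ofPred_eq, not_or, not_lt] at hω
      obtain ⟨h1, h2⟩ := hω
      have h3 := h2.trans (min_le_right _ _)
      have h4 := h2.trans (min_le_left _ _)
      rw [abs_le] at h1 h3
      refine (hunif _ ⟨by linarith, by linarith⟩ _ ⟨by linarith, by linarith⟩ ?_).le
      rw [Real.dist_eq]
      linarith
  have hind : Integrable (S.indicator fun _ => 2 * ‖f‖) (Q u) :=
    (integrable_const _).indicator hSm
  rw [dist_zero_right, ← integral_sub (hfi ha') (hfi hb')]
  calc _ ≤ ∫ ω, ε₀ + S.indicator (fun _ => 2 * ‖f‖) ω ∂Q u :=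
        norm_integral_le_of_norm_le ((integrable_const _).add hind) (.of_forall hpt)
    _ = ε₀ + (Q u).real S * (2 * ‖f‖) := by
        rw [integral_add (integrable_const _) hind, integral_indicator_const _ hSm]
        simp
    _ ≤ ε₀ + ε₀ * (2 * ‖f‖) := by
        gcongr
        exact ENNReal.toReal_le_of_le_ofReal hε₀pos.le hu
    _ < ε₀ * (2 * ‖f‖ + 2) := by nlinarith
    _ = ε := by rw [hε₀]; field_simp

lemma cond_apply_of_indepFun {P : Measure Ω} [IsFiniteMeasure P] {A ξ : Ω → ℝ}
    (hξ : Measurable ξ) (hind : IndepFun A ξ P) {u : ℝ}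
    (hu : P {ω | u < ξ ω} ≠ 0) {s : Set ℝ} (hs : MeasurableSet s) :
    P[|{ω | u < ξ ω}] (A ⁻¹' s) = P (A ⁻¹' s) := by
  have h := hind.measure_inter_preimage_eq_mul s (Set.Ioi u) hs measurableSet_Ioi
  have e : {ω | u < ξ ω} = ξ ⁻¹' Set.Ioi u := rfl
  rw [e] at hu ⊢
  rw [cond_apply (hξ measurableSet_Ioi), Set.inter_comm, h, mul_comm (P _), ← mul_assoc,
    ENNReal.inv_mul_cancel hu (measure_ne_top _ _), one_mul]

variable {P : Measure Ω} [IsProbabilityMeasure P] {v : NNReal} {ξ : Ω → ℝ}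

lemma eventually_cond_overshoot_le (hv : v ≠ 0) (hξ : Measurable ξ)
    (hlaw : P.map ξ = gaussianReal 0 v) {s : Set ℝ} (hs : MeasurableSet s) {ε : ℝ}
    (hε : (expMeasure 1).real s < ε) :
    ∀ᶠ u in atTop, P[|{ω | u < ξ ω}] {ω | u * (ξ ω - u) / v ∈ s} ≤ ENNReal.ofReal ε := by
  have h := tendsto_integral_cond_overshoot hv hξ hlaw
    (measurable_const.indicator hs : Measurable (s.indicator fun _ => (1 : ℝ))) (C := 1)
    (fun x => by by_cases hx : x ∈ s <;> simp [hx])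
  rw [integral_indicator_const _ hs, smul_eq_mul, mul_one] at h
  filter_upwards [h.eventually_lt_const hε] with u hu
  have : IsProbabilityMeasure (P[|{ω | u < ξ ω}]) :=
    cond_isProbabilityMeasure (measure_lt_ne_zero_of_map_eq_gaussianReal hv hξ hlaw u)
  have hm : MeasurableSet {ω | u * (ξ ω - u) / v ∈ s} :=
    (by fun_prop : Measurable fun ω => u * (ξ ω - u) / v) hs
  have e : ∀ ω, s.indicator (fun _ => (1 : ℝ)) (u * (ξ ω - u) / v) =
      {ω | u * (ξ ω - u) / v ∈ s}.indicator (fun _ => (1 : ℝ)) ω := fun ω => rfl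
  simp_rw [e] at hu
  rw [integral_indicator_const _ hm, smul_eq_mul, mul_one] at hu
  rw [← ofReal_measureReal]
  exact ENNReal.ofReal_le_ofReal hu.le

lemma expMeasure_one_real_Iic {x : ℝ} (hx : 0 ≤ x) :
    (expMeasure 1).real (Set.Iic x) = 1 - Real.exp (-x) := by
  have := isProbabilityMeasure_expMeasure one_pos
  rw [← cdf_eq_real, cdf_expMeasure_eq one_pos, if_pos hx, one_mul]

lemma exists_eventually_cond_overshoot_small_le (hv : v ≠ 0) (hξ : Measurable ξ)
    (hlaw : P.map ξ = gaussianReal 0 v) {ε : ℝ} (hε : 0 < ε) :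
    ∃ κ > 0, ∀ᶠ u in atTop,
      P[|{ω | u < ξ ω}] {ω | u * (ξ ω - u) / v ≤ κ} ≤ ENNReal.ofReal ε := by
  refine ⟨ε / 2, half_pos hε, eventually_cond_overshoot_le hv hξ hlaw
    (measurableSet_Iic (a := ε / 2)) ?_⟩
  rw [expMeasure_one_real_Iic (half_pos hε).le]
  linarith [Real.add_one_le_exp (-(ε / 2))]

lemma exists_eventually_cond_overshoot_large_le (hv : v ≠ 0) (hξ : Measurable ξ)
    (hlaw : P.map ξ = gaussianReal 0 v) {ε : ℝ} (hε : 0 < ε) :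
    ∃ M > 0, ∀ᶠ u in atTop,
      P[|{ω | u < ξ ω}] {ω | M < u * (ξ ω - u) / v} ≤ ENNReal.ofReal ε := by
  have hM : 0 < 1 / ε := by positivity
  refine ⟨1 / ε, hM, eventually_cond_overshoot_le hv hξ hlaw
    (measurableSet_Ioi (a := 1 / ε)) ?_⟩
  have := isProbabilityMeasure_expMeasure one_pos
  rw [← Set.compl_Iic, probReal_compl_eq_one_sub measurableSet_Iic,
    expMeasure_one_real_Iic hM.le, sub_sub_cancel, Real.exp_neg,
    inv_lt_comm₀ (Real.exp_pos _) hε, inv_eq_one_div]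
  linarith [Real.add_one_le_exp (1 / ε)]

end Closeness

section Conditional

variable {Ω : Type*} [MeasurableSpace Ω] {P : Measure Ω} [IsProbabilityMeasure P]
  {X : ℝ → Ω → ℝ} {R : ℝ → ℝ}

namespace IsZeroMeanGaussianProcess

lemma cond_ge_le_integral_sq_div (hX : IsZeroMeanGaussianProcess P X) {A : Ω → ℝ}
    (hA : A ∈ Submodule.span ℝ (Set.range X)) (h0 : ∫ ω, A ω * X 0 ω ∂P = 0) {u : ℝ}
    (hu : P {ω | u < X 0 ω} ≠ 0) {a : ℝ} (ha : 0 < a) :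
    P[|{ω | u < X 0 ω}] {ω | a ≤ |A ω|} ≤ ENNReal.ofReal ((∫ ω, A ω ^ 2 ∂P) / a ^ 2) := by
  have hAm := hX.measurable_of_mem_span hA
  have h := meas_ge_le_variance_div_sq (hX.memLp_two hA) ha
  rw [variance_of_integral_eq_zero hAm.aemeasurable (hX.integral_eq_zero hA)] at h
  simp only [hX.integral_eq_zero hA, sub_zero] at h
  exact (cond_apply_of_indepFun (hX.1 0)
    (hX.indepFun hA (Submodule.subset_span ⟨0, rfl⟩) h0) hu
    (measurableSet_le measurable_const measurable_id.abs :
      MeasurableSet {x : ℝ | a ≤ |x|})).trans_le h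

end IsZeroMeanGaussianProcess

end Conditional

section Local

lemma continuous_of_eq_integral_cos {μ : Measure ℝ} [IsFiniteMeasure μ] {R : ℝ → ℝ}
    (hR : ∀ t, R t = ∫ x, Real.cos (t * x) ∂μ) : Continuous R := by
  rw [show R = fun t => ∫ x, Real.cos (t * x) ∂μ from funext hR]
  exact continuous_of_dominated (bound := fun _ => 1) (fun t => by fun_prop)
    (fun t => .of_forall fun x => Real.abs_cos_le_one _) (integrable_const 1)
    (.of_forall fun x => by fun_prop)

lemma continuous_residualDeviation {Ω : Type*} {X : ℝ → Ω → ℝ} {R : ℝ → ℝ}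
    (hXc : ∀ ω, Continuous fun t => X t ω) (hRc : Continuous R) (u : ℝ) (ω : Ω) :
    Continuous fun t => residualDeviation X R u t ω := by
  have h := hXc ω
  unfold residualDeviation rescaledResidual
  have h1 : Continuous fun t => X (t / u) ω := h.comp (continuous_id.div_const u)
  have h2 : Continuous fun t => R (t / u) := hRc.comp (continuous_id.div_const u)
  fun_prop

/-- The rescaled path near the origin is close to the parabola with slope given by the residual. -/
lemma abs_rescaled_path_sub_parabola_le {Ω : Type*} {X : ℝ → Ω → ℝ} {R : ℝ → ℝ} {m M K δ u : ℝ}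
    {ω : Ω} (hm : 0 ≤ m) (hR0 : 0 < R 0) (hu : 0 < u)
    (hR : ∀ t, |t| ≤ K → |u ^ 2 * (R 0 - R (t / u)) - m * t ^ 2 / 2| ≤ R 0 * δ / 4)
    (hM : M * (m * K ^ 2 / 2 + R 0 * δ / 4) / u ^ 2 ≤ δ / 4)
    (hω0 : 0 ≤ u * (X 0 ω - u) / R 0) (hωM : u * (X 0 ω - u) / R 0 ≤ M) {t : ℝ} (ht : |t| ≤ K)
    (hD : |residualDeviation X R u t ω| ≤ δ / 2) :
    |u * (X (t / u) ω - u) - (u * (X 0 ω - u) + t * rescaledResidual X R u 1 ω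
      - m / R 0 * t ^ 2 / 2)| ≤ δ := by
  have hρ := hR t ht
  set ρ := u ^ 2 * (R 0 - R (t / u)) with hρdef
  set T := u * (X 0 ω - u) / R 0 with hT
  have e : u * (X (t / u) ω - u) - (u * (X 0 ω - u) + t * rescaledResidual X R u 1 ω
      - m / R 0 * t ^ 2 / 2) =
      residualDeviation X R u t ω - T * ρ / u ^ 2 - (ρ - m * t ^ 2 / 2) / R 0 := by
    rw [hT, hρdef]
    simp only [residualDeviation, rescaledResidual]
    field_simp
    ring
  have ht2 : t ^ 2 ≤ K ^ 2 := by rw [← sq_abs t]; gcongr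
  have hρK : |ρ| ≤ m * K ^ 2 / 2 + R 0 * δ / 4 := by
    have h1 : |ρ| ≤ |m * t ^ 2 / 2| + |ρ - m * t ^ 2 / 2| := by
      have := abs_add_le (m * t ^ 2 / 2) (ρ - m * t ^ 2 / 2)
      rwa [add_sub_cancel] at this
    rw [abs_of_nonneg (by positivity : 0 ≤ m * t ^ 2 / 2)] at h1
    have h2 : m * t ^ 2 / 2 ≤ m * K ^ 2 / 2 := by gcongr
    linarith
  have h1 : |T * ρ / u ^ 2| ≤ δ / 4 := by
    refine le_trans ?_ hM
    rw [abs_div, abs_mul, abs_of_nonneg hω0, abs_of_pos (by positivity : 0 < u ^ 2)]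
    have hM0 := hω0.trans hωM
    gcongr
  have h2 : |(ρ - m * t ^ 2 / 2) / R 0| ≤ δ / 4 := by
    rw [abs_div, abs_of_pos hR0, div_le_iff₀ hR0]
    linarith
  rw [e]
  rw [abs_le] at *
  constructor <;> linarith [h1.1, h1.2, h2.1, h2.2, hD.1, hD.2]

end Local

section Conditional

variable {Ω : Type*} [MeasurableSpace Ω] {P : Measure Ω} {X : ℝ → Ω → ℝ} {R : ℝ → ℝ}
  {μ : Measure ℝ} [IsFiniteMeasure μ]

namespace IsZeroMeanGaussianProcess

lemma map_zero_eq (hX : IsZeroMeanGaussianProcess P X)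
    (hcov : ∀ s t, ∫ ω, X s ω * X t ω ∂P = R (s - t)) {v : NNReal} (hv : (v : ℝ) = R 0) :
    P.map (X 0) = gaussianReal 0 v := by
  refine hX.map_eq (Submodule.subset_span ⟨0, rfl⟩) ?_
  simp_rw [pow_two]
  rw [hcov, hv, sub_zero]

lemma tendsto_integral_rescaledResidual_one_sq (hX : IsZeroMeanGaussianProcess P X)
    (hm : Integrable (fun x : ℝ => x ^ 2) μ)
    (hcov : ∀ s t, ∫ ω, X s ω * X t ω ∂P = R (s - t))
    (hR : ∀ t, R t = ∫ x, Real.cos (t * x) ∂μ) (hR0 : 0 < R 0) :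
    Tendsto (fun u => ∫ ω, rescaledResidual X R u 1 ω ^ 2 ∂P) atTop (𝓝 (∫ x, x ^ 2 ∂μ)) := by
  simp_rw [hX.integral_rescaledResidual_one_sq hcov hR0.ne']
  have h1 := tendsto_sq_mul_covariance_sub (tendsto_integral_cos_sub_div_sq hm hR)
  have h2 : Tendsto (fun u : ℝ => R (1 / u)) atTop (𝓝 (R 0)) := by
    refine (continuous_of_eq_integral_cos hR).continuousAt.tendsto.comp ?_
    exact tendsto_const_nhds.div_atTop tendsto_id
  have h3 := h1.mul ((h2.const_add (R 0)).div_const (R 0))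
  convert! h3 using 2
  field_simp
  ring

variable [IsProbabilityMeasure P]

/-- Conditionally on a high value at the origin, the residual is close to a line. -/
lemma cond_exists_lt_abs_residualDeviation_le (hX : IsZeroMeanGaussianProcess P X)
    (hXc : ∀ ω, Continuous fun t => X t ω) (hm : Integrable (fun x : ℝ => x ^ 2) μ)
    (hcov : ∀ s t, ∫ ω, X s ω * X t ω ∂P = R (s - t))
    (hR : ∀ t, R t = ∫ x, Real.cos (t * x) ∂μ) (hR0 : R 0 ≠ 0) {u K δ : ℝ} (hu : 0 < u)
    (hPu : P {ω | u < X 0 ω} ≠ 0) (hK : 1 ≤ K) (hδ : 0 < δ) {σ : ℝ} (hσ : |σ| = 1) :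
    P[|{ω | u < X 0 ω}]
        {ω | ∃ t ∈ Set.Icc (0 : ℝ) 1, δ < |residualDeviation X R u (σ * K * t) ω|} ≤
      ENNReal.ofReal (800 / 7 * (8 * K ^ 2 *
        ∫ x, (|x| * min 2 (K * |x| / u)) ^ 2 ∂μ) / δ ^ 2) := by
  have hI : 0 ≤ ∫ x, (|x| * min 2 (K * |x| / u)) ^ 2 ∂μ := integral_nonneg fun x => sq_nonneg _
  have hσK : ∀ t ∈ Set.Icc (0 : ℝ) 1, |σ * K * t| ≤ K := fun t ht => by
    rw [abs_mul, abs_mul, hσ, one_mul, abs_of_pos (by linarith : 0 < K), abs_of_nonneg ht.1]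
    exact mul_le_of_le_one_right (by linarith) ht.2
  refine measure_exists_lt_abs_le
    (Z := fun t ω => residualDeviation X R u (σ * K * t) ω) (fun ω => ?_) (fun ω => ?_)
    (by positivity) hδ fun s hs t ht a ha => ?_
  · exact (continuous_residualDeviation hXc (continuous_of_eq_integral_cos hR) u ω).comp
      (continuous_const.mul continuous_id)
  · rw [mul_zero, residualDeviation_zero X hR0]
  · refine (hX.cond_ge_le_integral_sq_div (sub_mem (residualDeviation_mem_span X R u (σ * K * t))
      (residualDeviation_mem_span X R u (σ * K * s)))
      (hX.integral_residualDeviation_sub_mul hcov hR0 u _ _) hPu ha).trans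
      (ENNReal.ofReal_le_ofReal ?_)
    gcongr
    refine (hX.integral_residualDeviation_sub_sq_le hm hcov hR hR0 hu hK (hσK s hs)
      (hσK t ht)).trans_eq ?_
    have hσ2 : σ ^ 2 = 1 := by rw [← sq_abs, hσ, one_pow]
    linear_combination 8 * (∫ x, (|x| * min 2 (K * |x| / u)) ^ 2 ∂μ) * K ^ 2 * (t - s) ^ 2 * hσ2

lemma eventually_cond_abs_residualDeviation_le (hX : IsZeroMeanGaussianProcess P X)
    (hXc : ∀ ω, Continuous fun t => X t ω) (hm : Integrable (fun x : ℝ => x ^ 2) μ)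
    (hcov : ∀ s t, ∫ ω, X s ω * X t ω ∂P = R (s - t))
    (hR : ∀ t, R t = ∫ x, Real.cos (t * x) ∂μ) (hR0 : R 0 ≠ 0)
    (hP : ∀ u, P {ω | u < X 0 ω} ≠ 0) {K δ ε : ℝ} (hK : 1 ≤ K) (hδ : 0 < δ) (hε : 0 < ε) {σ : ℝ}
    (hσ : |σ| = 1) :
    ∀ᶠ u in atTop, P[|{ω | u < X 0 ω}]
        {ω | ∃ t ∈ Set.Icc (0 : ℝ) 1, δ < |residualDeviation X R u (σ * K * t) ω|} ≤
      ENNReal.ofReal ε := by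
  have h := (((tendsto_integral_sq_mul_min hm K (by linarith)).const_mul
    (8 * K ^ 2)).const_mul (800 / 7)).div_const (δ ^ 2)
  simp only [mul_zero, zero_div] at h
  filter_upwards [h.eventually_lt_const hε, eventually_gt_atTop 0] with u hlt hu
  exact (hX.cond_exists_lt_abs_residualDeviation_le hXc hm hcov hR hR0 hu (hP u) hK hδ hσ).trans
    (ENNReal.ofReal_le_ofReal hlt.le)

lemma exists_eventually_cond_le_abs_rescaledResidual_le (hX : IsZeroMeanGaussianProcess P X)
    (hm : Integrable (fun x : ℝ => x ^ 2) μ)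
    (hcov : ∀ s t, ∫ ω, X s ω * X t ω ∂P = R (s - t))
    (hR : ∀ t, R t = ∫ x, Real.cos (t * x) ∂μ) (hR0 : 0 < R 0)
    (hP : ∀ u, P {ω | u < X 0 ω} ≠ 0) {ε : ℝ} (hε : 0 < ε) :
    ∃ N > 0, ∀ᶠ u in atTop, P[|{ω | u < X 0 ω}] {ω | N ≤ |rescaledResidual X R u 1 ω|} ≤
      ENNReal.ofReal ε := by
  set m := ∫ x, x ^ 2 ∂μ with hmdef
  have hm0 : 0 ≤ m := integral_nonneg fun x => sq_nonneg x
  have hN : 1 ≤ 1 + (m + 1) / ε := by simp; positivity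
  refine ⟨1 + (m + 1) / ε, by positivity, ?_⟩
  filter_upwards [(hX.tendsto_integral_rescaledResidual_one_sq hm hcov hR hR0).eventually_lt_const
    (lt_add_one m)] with u hu
  refine (hX.cond_ge_le_integral_sq_div (rescaledResidual_mem_span X R u 1)
    (hX.integral_rescaledResidual_mul hcov hR0.ne' u 1) (hP u) (by positivity)).trans
    (ENNReal.ofReal_le_ofReal ?_)
  rw [div_le_iff₀ (by positivity)]
  calc _ ≤ m + 1 := hu.le
    _ = ε * ((m + 1) / ε) := by field_simp
    _ ≤ ε * (1 + (m + 1) / ε) ^ 2 := by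
      gcongr
      nlinarith

/-- Conditionally on a high value at the origin, the rescaled excursion length is close to the
length of the excursion of the limiting parabola. -/
lemma exists_eventually_cond_excursion_length_le (hX : IsZeroMeanGaussianProcess P X)
    (hXc : ∀ ω, Continuous fun t => X t ω) (hm : Integrable (fun x : ℝ => x ^ 2) μ)
    (hcov : ∀ s t, ∫ ω, X s ω * X t ω ∂P = R (s - t))
    (hR : ∀ t, R t = ∫ x, Real.cos (t * x) ∂μ) (hR0 : 0 < R 0) (hm0 : 0 < ∫ x, x ^ 2 ∂μ)
    {c : ℝ} (hc : c = (∫ x, x ^ 2 ∂μ) / R 0) {ε : ℝ} (hε : 0 < ε) :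
    ∃ B, ∀ δ > 0, ∀ᶠ u in atTop, P[|{ω | u < X 0 ω}] {ω |
      B < |2 / c * √(rescaledResidual X R u 1 ω ^ 2 + 2 * c * (u * (X 0 ω - u)))| ∨
      δ < |u * (sInf {t : ℝ | 0 ≤ t ∧ X t ω ≤ u} - sSup {t : ℝ | t ≤ 0 ∧ X t ω ≤ u}) -
        2 / c * √(rescaledResidual X R u 1 ω ^ 2 + 2 * c * (u * (X 0 ω - u)))|} ≤
      ENNReal.ofReal ε := by
  set m := ∫ x, x ^ 2 ∂μ with hmdef
  have hc0 : 0 < c := by rw [hc]; positivity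
  obtain ⟨v, hv⟩ : ∃ v : NNReal, (v : ℝ) = R 0 := ⟨⟨R 0, hR0.le⟩, rfl⟩
  have hv0 : v ≠ 0 := fun h => hR0.ne' (by rw [← hv, h, NNReal.coe_zero])
  have hlaw := hX.map_zero_eq hcov hv
  have hP := measure_lt_ne_zero_of_map_eq_gaussianReal hv0 (hX.1 0) hlaw
  have hε5 : 0 < ε / 5 := by positivity
  obtain ⟨κ, hκ, hκu⟩ := exists_eventually_cond_overshoot_small_le hv0 (hX.1 0) hlaw hε5
  obtain ⟨M, hM, hMu⟩ := exists_eventually_cond_overshoot_large_le hv0 (hX.1 0) hlaw hε5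
  obtain ⟨N, hN, hNu⟩ :=
    hX.exists_eventually_cond_le_abs_rescaledResidual_le hm hcov hR hR0 hP hε5
  rw [hv] at hκu hMu
  refine ⟨2 / c * √(N ^ 2 + 2 * c * (R 0 * M)), fun δ' hδ' => ?_⟩
  set δ := min (R 0 * κ / 2) (c * δ' ^ 2 / 8) with hδdef
  have hδ : 0 < δ := by positivity
  have hδκ : δ < R 0 * κ := (min_le_left _ _).trans_lt (half_lt_self (by positivity))
  have hδδ' : 2 / c * √(2 * c * δ) ≤ δ' := by
    have h1 : 2 * c * δ ≤ (c * δ' / 2) ^ 2 := by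
      calc 2 * c * δ ≤ 2 * c * (c * δ' ^ 2 / 8) := by gcongr; exact min_le_right _ _
        _ = _ := by ring
    calc 2 / c * √(2 * c * δ) ≤ 2 / c * (c * δ' / 2) := by
          gcongr
          exact Real.sqrt_le_iff.2 ⟨by positivity, h1⟩
      _ = δ' := by field_simp
  set K := max 1 ((N + √(N ^ 2 + 2 * c * (R 0 * M + δ))) / c) with hKdef
  have hK : 1 ≤ K := le_max_left _ _
  have hlim : Tendsto (fun u : ℝ => M * (m * K ^ 2 / 2 + R 0 * δ / 4) / u ^ 2) atTop (𝓝 0) :=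
    tendsto_const_nhds.div_atTop (tendsto_pow_atTop two_ne_zero)
  filter_upwards [hκu, hMu, hNu, eventually_gt_atTop 0,
    hX.eventually_cond_abs_residualDeviation_le hXc hm hcov hR hR0.ne' hP hK (half_pos hδ) hε5
      (σ := 1) (by simp),
    hX.eventually_cond_abs_residualDeviation_le hXc hm hcov hR hR0.ne' hP hK (half_pos hδ) hε5
      (σ := -1) (by simp),
    eventually_forall_abs_rescaled_covariance_le (tendsto_integral_cos_sub_div_sq hm hR) K
      (by positivity : 0 < R 0 * δ / 4),
    hlim.eventually_le_const (by positivity : 0 < δ / 4)]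
    with u hκu hMu hNu hu hD hD' hRu hMlim
  set Q := P[|{ω | u < X 0 ω}]
  set S₁ := {ω | u * (X 0 ω - u) / R 0 ≤ κ}
  set S₂ := {ω | M < u * (X 0 ω - u) / R 0}
  set S₃ := {ω | N ≤ |rescaledResidual X R u 1 ω|}
  set S₄ := {ω | ∃ t ∈ Set.Icc (0 : ℝ) 1, δ / 2 < |residualDeviation X R u (1 * K * t) ω|}
  set S₅ := {ω | ∃ t ∈ Set.Icc (0 : ℝ) 1, δ / 2 < |residualDeviation X R u (-1 * K * t) ω|}
  calc _ ≤ Q (S₁ ∪ S₂ ∪ S₃ ∪ S₄ ∪ S₅) := measure_mono fun ω hω => ?_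
    _ ≤ ENNReal.ofReal (ε / 5) + ENNReal.ofReal (ε / 5) + ENNReal.ofReal (ε / 5) +
        ENNReal.ofReal (ε / 5) + ENNReal.ofReal (ε / 5) :=
      (measure_union_le _ _).trans (add_le_add ((measure_union_le _ _).trans
        (add_le_add ((measure_union_le _ _).trans (add_le_add ((measure_union_le _ _).trans
          (add_le_add hκu hMu)) hNu)) hD)) hD')
    _ = ENNReal.ofReal ε := by
      rw [← ENNReal.ofReal_add hε5.le hε5.le, ← ENNReal.ofReal_add (by positivity) hε5.le,
        ← ENNReal.ofReal_add (by positivity) hε5.le, ← ENNReal.ofReal_add (by positivity) hε5.le]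
      congr 1
      ring
  contrapose! hω
  simp only [Set.mem_union, not_or] at hω
  obtain ⟨⟨⟨⟨h1, h2⟩, h3⟩, h4⟩, h5⟩ := hω
  simp only [S₁, S₂, S₃, S₄, S₅, Set.mem_ofPred_eq, not_exists, not_and, not_lt, not_le]
    at h1 h2 h3 h4 h5
  have hKpos : 0 < K := by linarith
  have hdev : ∀ t, |t| ≤ K → |residualDeviation X R u t ω| ≤ δ / 2 := fun t ht => by
    have ht1 : |t| / K ≤ 1 := (div_le_one hKpos).2 ht
    rcases le_total 0 t with h0 | h0
    · rw [abs_of_nonneg h0] at ht1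
      have := h4 (t / K) ⟨by positivity, ht1⟩
      rwa [one_mul, mul_div_cancel₀ _ hKpos.ne'] at this
    · rw [abs_of_nonpos h0] at ht1
      have := h5 (-t / K) ⟨div_nonneg (by linarith) hKpos.le, ht1⟩
      rwa [show -1 * K * (-t / K) = t by field_simp] at this
  have hθ : R 0 * κ < u * (X 0 ω - u) := by rwa [lt_div_iff₀ hR0, mul_comm] at h1
  have hθM : u * (X 0 ω - u) ≤ R 0 * M := by rwa [div_le_iff₀ hR0, mul_comm M] at h2
  have hη2 : rescaledResidual X R u 1 ω ^ 2 ≤ N ^ 2 := by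
    rw [← sq_abs]; gcongr
  rw [Set.mem_ofPred_eq, not_or, not_lt, not_lt]
  constructor
  · rw [abs_of_nonneg (by positivity)]
    gcongr
  · refine (abs_excursion_length_sub_le (x := fun t => X t ω) (K := K) hu hc0 hδ.le
      (hδκ.trans hθ) (le_trans ?_ (le_max_right _ _)) fun t ht => ?_).trans hδδ'
    · gcongr
    · rw [hc]
      exact abs_rescaled_path_sub_parabola_le hm0.le hR0 hu hRu hMlim (hκ.trans h1).le h2 ht
        (hdev t ht)

end IsZeroMeanGaussianProcess

end Conditional

lemma integral_prod_gaussian_exp_eq {m v : ℝ} (hm : 0 < m) (f : BoundedContinuousFunction ℝ ℝ) :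
    ∫ s, ∫ z, f (2 / (m / v) * √((√m * z) ^ 2 + 2 * m * s)) ∂gaussianReal 0 1 ∂expMeasure 1 =
      ∫ p : ℝ × ℝ, f (2 * (v / √m) * √(p.1 ^ 2 + 2 * p.2))
        ∂((gaussianReal 0 1).prod (expMeasure 1)) := by
  have := isProbabilityMeasure_expMeasure one_pos
  have hint : Integrable (fun p : ℝ × ℝ => f (2 * (v / √m) * √(p.1 ^ 2 + 2 * p.2)))
      ((gaussianReal 0 1).prod (expMeasure 1)) :=
    .of_bound (f.continuous.measurable.comp (by fun_prop)).aestronglyMeasurable ‖f‖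
      (.of_forall fun p => f.norm_coe_le_norm _)
  rw [integral_prod_symm _ hint]
  congr 1 with s
  congr 1 with z
  congr 1
  rw [show (√m * z) ^ 2 + 2 * m * s = m * (z ^ 2 + 2 * s) by
    rw [mul_pow, Real.sq_sqrt hm.le]; ring, Real.sqrt_mul hm.le]
  have h := Real.mul_self_sqrt hm.le
  have h0 := Real.sqrt_pos.2 hm
  field_simp
  rw [pow_two, h]
  ring

/-- in the finite-second-spectral-moment regime, conditionally on `[X₀ > u]`,
`u (τ_u⁺ - τ_u⁻)` converges in distribution, as `u → ∞`, to
`2 (R(0)/√(-R''(0))) √(Z² + 2T*)` where `Z` is standard normal and `T*` standard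
exponential, independent of each other (here realized on the product measure
`(gaussianReal 0 1).prod (expMeasure 1)`). -/
theorem excursion_stmt1
    (μ : Measure ℝ) [IsFiniteMeasure μ]
    (hμ_nonnull : μ Set.univ ≠ 0)
    (hμ_symm : μ.map (fun x => -x) = μ)
    (hμ_mom2 : Integrable (fun x : ℝ => x ^ 2) μ)
    (hμ_nondeg : 0 < μ ({(0 : ℝ)}ᶜ))
    (R : ℝ → ℝ)
    (hR : ∀ t : ℝ, (R t : ℂ) = ∫ x : ℝ, Complex.exp (Complex.I * t * x) ∂μ)
    {Ω : Type*} [MeasurableSpace Ω] (P : Measure Ω) [IsProbabilityMeasure P]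
    (X : ℝ → Ω → ℝ)
    (hX_gauss : IsZeroMeanGaussianProcess P X)
    (hX_cont : ∀ ω, Continuous fun t => X t ω)
    (hX_cov : ∀ s t : ℝ, ∫ ω, X s ω * X t ω ∂P = R (s - t)) :
    ∀ f : BoundedContinuousFunction ℝ ℝ,
      Tendsto (fun u : ℝ =>
          ∫ ω, f (u * (sInf {t : ℝ | 0 ≤ t ∧ X t ω ≤ u}
              - sSup {t : ℝ | t ≤ 0 ∧ X t ω ≤ u})) ∂(P[|{ω | u < X 0 ω}]))
        atTop
        (nhds (∫ p : ℝ × ℝ,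
            f (2 * (R 0 / Real.sqrt (-(deriv (deriv R) 0))) * Real.sqrt (p.1 ^ 2 + 2 * p.2))
          ∂((gaussianReal 0 1).prod (expMeasure 1)))) := by
  intro f
  have hcos := covariance_eq_integral_cos hR
  have hm0 : 0 < ∫ x, x ^ 2 ∂μ := by
    rw [integral_pos_iff_support_of_nonneg (fun x => sq_nonneg x) hμ_mom2]
    convert! hμ_nondeg using 2
    ext x
    simp
  have hR0 : 0 < R 0 := by
    rw [hcos]
    simpa [Measure.real, ENNReal.toReal_pos_iff, measure_lt_top, pos_iff_ne_zero] using hμ_nonnull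
  rw [deriv_deriv_integral_cos hμ_mom2 hcos, neg_neg, ← integral_prod_gaussian_exp_eq hm0]
  set m := ∫ x, x ^ 2 ∂μ with hm
  obtain ⟨v, hv⟩ : ∃ v : NNReal, (v : ℝ) = R 0 := ⟨⟨R 0, hR0.le⟩, rfl⟩
  have hv0 : v ≠ 0 := fun h => hR0.ne' (by rw [← hv, h, NNReal.coe_zero])
  have hlaw := hX_gauss.map_zero_eq hX_cov hv
  have hP := measure_lt_ne_zero_of_map_eq_gaussianReal hv0 (hX_gauss.1 0) hlaw
  have hQ : ∀ u, IsProbabilityMeasure (P[|{ω | u < X 0 ω}]) := fun u =>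
    cond_isProbabilityMeasure (hP u)
  have hη : ∀ u, Measurable (rescaledResidual X R u 1) := fun u =>
    hX_gauss.measurable_of_mem_span (rescaledResidual_mem_span X R u 1)
  have hX0 := hX_gauss.1 0
  have hw : ∀ u, 0 ≤ ∫ ω, rescaledResidual X R u 1 ω ^ 2 ∂P := fun u =>
    integral_nonneg fun ω => sq_nonneg _
  have hlim := tendsto_integral_cond_overshoot_prod hv0 hX0 hlaw hη
    (fun u => hX_gauss.indepFun (rescaledResidual_mem_span X R u 1)
      (Submodule.subset_span ⟨0, rfl⟩)
      (hX_gauss.integral_rescaledResidual_mul hX_cov hR0.ne' u 1))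
    (w := fun u => ⟨_, hw u⟩)
    (fun u => hX_gauss.map_eq (rescaledResidual_mem_span X R u 1) rfl) (l := √m)
    (hX_gauss.tendsto_integral_rescaledResidual_one_sq hμ_mom2 hX_cov hcos hR0).sqrt
    (φ := fun p => f (2 / (m / R 0) * √(p.1 ^ 2 + 2 * m * p.2)))
    (f.continuous.comp (by fun_prop)) (C := ‖f‖) (fun p => f.norm_coe_le_norm _)
  have hclose := tendsto_integral_sub_of_eventually_close (Q := fun u => P[|{ω | u < X 0 ω}])
    (a := fun u ω => u * (sInf {t : ℝ | 0 ≤ t ∧ X t ω ≤ u} - sSup {t : ℝ | t ≤ 0 ∧ X t ω ≤ u}))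
    (b := fun u ω => 2 / (m / R 0) *
      √(rescaledResidual X R u 1 ω ^ 2 + 2 * (m / R 0) * (u * (X 0 ω - u))))
    (fun u => (measurable_excursion_length hX_gauss.1 hX_cont u).const_mul u)
    (fun u => by have := hη u; fun_prop)
    (fun ε hε => hX_gauss.exists_eventually_cond_excursion_length_le hX_cont hμ_mom2 hX_cov hcos
      hR0 hm0 rfl hε) f
  have hsum := hclose.add hlim
  rw [zero_add] at hsum
  refine hsum.congr fun u => ?_
  rw [sub_add_eq_add_sub, add_sub_assoc, add_eq_left, sub_eq_zero]
  congr 1 with ω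
  rw [hv]
  congr 3
  ring
end

section
/- Let μ be a finite non-null symmetric measure on ℝ whose upper tail μ([x,∞)) is positive for all x > 0 and regularly varying at infinity with index −α for some 0 < α < 2, i.e. μ([cx,∞))/μ([x,∞)) → c^{−α} as x → ∞ for every c > 0. Let R(t) = ∫ e^{itx} μ(dx). Then R(0) − R(t) ~ C_α μ([t^{−1},∞)) as t ↓ 0, where C_α = π/(Γ(α) sin(πα/2)); consequently R(t) = R(0) + O(|t|^ε) as t → 0 for every ε ∈ (0, α). -/
open MeasureTheory ProbabilityTheory Filter

section Potter

variable {G : ℝ → ℝ} {α : ℝ}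

/-- One-sided Potter bound for a positive antitone regularly varying function. -/
theorem exists_rpow_mul_le_of_regularlyVarying (hanti : Antitone G) (hpos : ∀ x > 0, 0 < G x)
    (hrv : Tendsto (fun x => G (2 * x) / G x) atTop (nhds ((2 : ℝ) ^ (-α))))
    {β : ℝ} (hβ0 : 0 < β) (hβ : α < β) :
    ∃ C X : ℝ, 0 < C ∧ 0 < X ∧ ∀ x ≥ X, ∀ y, 0 < y → y ≤ x → y ^ β * G y ≤ C * (x ^ β * G x) := by
  have hlt : (2 : ℝ) ^ (-β) < 2 ^ (-α) :=
    Real.rpow_lt_rpow_of_exponent_lt (by norm_num) (by linarith)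
  obtain ⟨X₀, hX₀⟩ := eventually_atTop.1 (hrv.eventually (lt_mem_nhds hlt))
  set X := max X₀ 1 with hX
  have hX1 : 1 ≤ X := le_max_right _ _
  have hXpos : 0 < X := by linarith
  have hstep : ∀ x ≥ X, x ^ β * G x ≤ (2 * x) ^ β * G (2 * x) := by
    intro x hx
    have hx0 : 0 < x := by linarith
    have h := (hX₀ x ((le_max_left _ _).trans hx))
    rw [lt_div_iff₀ (hpos x hx0), Real.rpow_neg (by norm_num), inv_mul_lt_iff₀ (by positivity)] at h
    rw [Real.mul_rpow (by norm_num) hx0.le]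
    have : 0 < x ^ β := by positivity
    nlinarith
  have hmain : ∀ n : ℕ, ∀ y ≥ X, ∀ x, y ≤ x → x ≤ 2 ^ n * y →
      y ^ β * G y ≤ 2 ^ β * (x ^ β * G x) := by
    intro n
    induction n with
    | zero =>
      intro y hy x hxy hx
      have hxy : x = y := le_antisymm (by simpa using hx) hxy
      subst hxy
      have hx0 : 0 < x := by linarith
      have := hpos x hx0
      exact le_mul_of_one_le_left (by positivity) (Real.one_le_rpow (by norm_num) hβ0.le)
    | succ n ih =>
      intro y hy x hxy hx
      have hy0 : 0 < y := by linarith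
      rcases le_total x (2 * y) with h | h
      · calc y ^ β * G y ≤ (2 * y) ^ β * G (2 * y) := hstep y hy
          _ ≤ (2 * x) ^ β * G x := by
            have := hpos (2 * y) (by linarith)
            have := hanti h
            have : 0 ≤ (2 * x) ^ β := Real.rpow_nonneg (by linarith) _
            gcongr
          _ = 2 ^ β * (x ^ β * G x) := by
            rw [Real.mul_rpow (by norm_num) (by linarith)]; ring
      · exact (hstep y hy).trans (ih (2 * y) (by linarith) x h (by rw [pow_succ] at hx; linarith))
  have hmain' : ∀ y ≥ X, ∀ x, y ≤ x → y ^ β * G y ≤ 2 ^ β * (x ^ β * G x) := by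
    intro y hy x hxy
    have hy0 : 0 < y := by linarith
    obtain ⟨n, hn⟩ := pow_unbounded_of_one_lt (x / y) (by norm_num : (1 : ℝ) < 2)
    exact hmain n y hy x hxy ((div_le_iff₀ hy0).1 hn.le)
  have hφX : 0 < X ^ β * G X := mul_pos (by positivity) (hpos X hXpos)
  have hG0 : 0 < G 0 := (hpos 1 one_pos).trans_le (hanti zero_le_one)
  set D := X ^ β * G 0 / (X ^ β * G X)
  have hD : 0 ≤ D := by positivity
  have h2 : (0 : ℝ) < 2 ^ β := by positivity
  refine ⟨2 ^ β * (1 + D), X, by positivity, hXpos, fun x hx y hy hyx => ?_⟩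
  have hx0 : 0 < x := by linarith
  have hφx : 0 < x ^ β * G x := mul_pos (by positivity) (hpos x hx0)
  rcases le_total X y with h | h
  · refine (hmain' y h x hyx).trans ?_
    have : 0 ≤ 2 ^ β * D * (x ^ β * G x) := by positivity
    linarith
  · calc y ^ β * G y ≤ X ^ β * G 0 := by
          have := hpos y hy
          have := hanti hy.le
          gcongr
      _ = D * (X ^ β * G X) := by exact (div_mul_cancel₀ _ hφX.ne').symm
      _ ≤ D * (2 ^ β * (x ^ β * G x)) := mul_le_mul_of_nonneg_left (hmain' X le_rfl x hx) hD
      _ ≤ 2 ^ β * (1 + D) * (x ^ β * G x) := by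
        have : 0 ≤ 2 ^ β * (x ^ β * G x) := by positivity
        linarith

theorem exists_rpow_mul_bounded_of_regularlyVarying (hanti : Antitone G) (hpos : ∀ x > 0, 0 < G x)
    (hrv : Tendsto (fun x => G (2 * x) / G x) atTop (nhds ((2 : ℝ) ^ (-α))))
    {ε : ℝ} (hε0 : 0 < ε) (hε : ε < α) :
    ∃ C X : ℝ, 0 < X ∧ ∀ x ≥ X, x ^ ε * G x ≤ C := by
  have hlt : (2 : ℝ) ^ (-α) < 2 ^ (-ε) :=
    Real.rpow_lt_rpow_of_exponent_lt (by norm_num) (by linarith)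
  obtain ⟨X₀, hX₀⟩ := eventually_atTop.1 (hrv.eventually (gt_mem_nhds hlt))
  set X := max X₀ 1 with hX
  have hX1 : 1 ≤ X := le_max_right _ _
  have hXpos : 0 < X := by linarith
  have hstep : ∀ x ≥ X, (2 * x) ^ ε * G (2 * x) ≤ x ^ ε * G x := by
    intro x hx
    have hx0 : 0 < x := by linarith
    have h := (hX₀ x ((le_max_left _ _).trans hx))
    rw [div_lt_iff₀ (hpos x hx0), Real.rpow_neg (by norm_num), lt_inv_mul_iff₀ (by positivity)] at h
    rw [Real.mul_rpow (by norm_num) hx0.le]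
    have : 0 < x ^ ε := by positivity
    nlinarith
  have hmain : ∀ n : ℕ, ∀ x ≥ X, x ≤ 2 ^ n * (2 * X) → x ^ ε * G x ≤ (2 * X) ^ ε * G 0 := by
    intro n
    induction n with
    | zero =>
      intro x hx hx2
      have hx0 : 0 < x := by linarith
      have := hpos x hx0
      have := hanti hx0.le
      rw [pow_zero, one_mul] at hx2
      gcongr
    | succ n ih =>
      intro x hx hx2
      have hx0 : 0 < x := by linarith
      rcases le_total x (2 * X) with h | h
      · have := hpos x hx0
        have := hanti hx0.le
        gcongr
      · have := hstep (x / 2) (by linarith)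
        rw [mul_div_cancel₀ _ (by norm_num)] at this
        exact this.trans (ih (x / 2) (by linarith) (by rw [pow_succ] at hx2; linarith))
  refine ⟨(2 * X) ^ ε * G 0, X, hXpos, fun x hx => ?_⟩
  obtain ⟨n, hn⟩ := pow_unbounded_of_one_lt (x / (2 * X)) (by norm_num : (1 : ℝ) < 2)
  exact hmain n x hx ((div_le_iff₀ (by positivity)).1 hn.le)

end Potter

section SineIntegral

open Set Real

theorem integral_rpow_mul_exp_neg_mul_one_add_sq {α r : ℝ} (hα : 0 < α) (hr : 0 < r) :
    ∫ s in Ioi (0 : ℝ), s ^ (α - 1) * exp (-(r * (1 + s ^ 2))) =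
      exp (-r) * r ^ (1 - α / 2 - 1) * (Gamma (α / 2) / 2) := by
  have h := integral_rpow_mul_exp_neg_mul_rpow (p := 2) (q := α - 1) (b := r) (by norm_num)
    (by linarith) hr
  have : ∀ s : ℝ, s ^ (α - 1) * exp (-(r * (1 + s ^ 2))) =
      exp (-r) * (s ^ (α - 1) * exp (-r * s ^ (2 : ℝ))) := by
    intro s
    rw [show -(r * (1 + s ^ 2)) = -r + -r * s ^ 2 by ring, exp_add, rpow_two]
    ring
  simp_rw [this]
  rw [integral_const_mul, h]
  ring_nf

theorem integrable_rpow_mul_exp_neg_mul_one_add_sq {α : ℝ} (hα : 0 < α) (hα2 : α < 2) :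
    Integrable (fun p : ℝ × ℝ => p.1 ^ (α - 1) * exp (-(p.2 * (1 + p.1 ^ 2))))
      ((volume.restrict (Ioi 0)).prod (volume.restrict (Ioi 0))) := by
  rw [integrable_prod_iff' (by fun_prop)]
  constructor
  · filter_upwards [ae_restrict_mem measurableSet_Ioi] with r hr
    have h := integrableOn_rpow_mul_exp_neg_mul_sq (b := r) hr (s := α - 1) (by linarith)
    refine (h.const_mul (exp (-r))).congr (ae_of_all _ fun s => ?_)
    simp only
    rw [show -(r * (1 + s ^ 2)) = -r + -r * s ^ 2 by ring, exp_add]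
    ring
  · have h := (GammaIntegral_convergent (s := 1 - α / 2) (by linarith)).mul_const
      (Gamma (α / 2) / 2)
    refine h.congr ?_
    filter_upwards [ae_restrict_mem measurableSet_Ioi] with r hr
    rw [← integral_rpow_mul_exp_neg_mul_one_add_sq hα hr]
    refine setIntegral_congr_fun measurableSet_Ioi fun s hs => ?_
    have hs : 0 < s := hs
    rw [norm_of_nonneg (by positivity)]

theorem integral_exp_neg_mul_one_add_sq (s : ℝ) :
    ∫ r in Ioi (0 : ℝ), exp (-(r * (1 + s ^ 2))) = 1 / (1 + s ^ 2) := by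
  have h := integral_exp_neg_mul_rpow (p := 1) (b := 1 + s ^ 2) one_pos (by positivity)
  simp only [rpow_one, rpow_neg_one, div_one] at h
  simp_rw [show ∀ r : ℝ, -(r * (1 + s ^ 2)) = -(1 + s ^ 2) * r by intro r; ring]
  rw [h]
  norm_num [Gamma_two]

theorem integrableOn_rpow_div_one_add_sq {α : ℝ} (hα : 0 < α) (hα2 : α < 2) :
    IntegrableOn (fun s : ℝ => s ^ (α - 1) / (1 + s ^ 2)) (Ioi 0) := by
  refine (integrable_rpow_mul_exp_neg_mul_one_add_sq hα hα2).integral_prod_left.congr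
    (ae_of_all _ fun s => ?_)
  simp only
  rw [integral_const_mul, integral_exp_neg_mul_one_add_sq, mul_one_div]

theorem integral_rpow_div_one_add_sq {α : ℝ} (hα : 0 < α) (hα2 : α < 2) :
    ∫ s in Ioi (0 : ℝ), s ^ (α - 1) / (1 + s ^ 2) = π / (2 * sin (π * α / 2)) := by
  have h := integral_integral_swap
    (f := fun s r : ℝ => s ^ (α - 1) * exp (-(r * (1 + s ^ 2)))) (integrable_rpow_mul_exp_neg_mul_one_add_sq hα hα2)
  simp_rw [integral_const_mul, integral_exp_neg_mul_one_add_sq, mul_one_div] at h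
  rw [h, setIntegral_congr_fun measurableSet_Ioi
    fun r hr => integral_rpow_mul_exp_neg_mul_one_add_sq hα hr, integral_mul_const,
    ← Gamma_eq_integral (by linarith), ← mul_div_assoc, mul_comm (Gamma _),
    Gamma_mul_Gamma_one_sub, mul_div_assoc]
  field_simp

theorem integral_sin_mul_exp_neg_mul (k : ℕ) (s : ℝ) :
    ∫ v in (0 : ℝ)..(k * (2 * π)), sin v * exp (-(s * v)) =
      (1 - exp (-(s * (k * (2 * π))))) / (1 + s ^ 2) := by
  have hs : (1 + s ^ 2 : ℝ) ≠ 0 := by positivity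
  have hd : ∀ v : ℝ, HasDerivAt
      (fun v : ℝ => -(exp (-(s * v)) * (s * sin v + cos v)) / (1 + s ^ 2))
      (sin v * exp (-(s * v))) v := by
    intro v
    have h1 : HasDerivAt (fun v : ℝ => exp (-(s * v))) (exp (-(s * v)) * (-(s * 1))) v :=
      (((hasDerivAt_id v).const_mul s).neg).exp
    have h2 : HasDerivAt (fun v : ℝ => s * sin v + cos v) (s * cos v + -sin v) v :=
      ((hasDerivAt_sin v).const_mul s).add (hasDerivAt_cos v)
    refine ((h1.mul h2).neg.div_const (1 + s ^ 2)).congr_deriv ?_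
    field_simp
    ring
  rw [intervalIntegral.integral_eq_sub_of_hasDerivAt (fun v _ => hd v)
    (Continuous.intervalIntegrable (by fun_prop) _ _)]
  have hsin : sin (k * (2 * π)) = 0 := by
    have := sin_nat_mul_pi (k * 2)
    push_cast at this
    rw [← this]; ring_nf
  rw [hsin, cos_nat_mul_two_pi]
  simp
  ring

theorem integral_exp_neg_mul_rpow_eq {α v : ℝ} (hα : 0 < α) (hv : 0 < v) :
    ∫ s in Ioi (0 : ℝ), s ^ (α - 1) * exp (-(s * v)) = v ^ (-α) * Gamma α := by
  have h := integral_rpow_mul_exp_neg_mul_Ioi hα hv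
  simp_rw [mul_comm v] at h
  rw [h, one_div, inv_rpow hv.le, rpow_neg hv.le]

theorem integrable_sin_mul_rpow_mul_exp {α : ℝ} (hα : 0 < α) (hα2 : α < 2) {M : ℝ} (hM : 0 ≤ M) :
    Integrable (fun p : ℝ × ℝ => sin p.1 * (p.2 ^ (α - 1) * exp (-(p.2 * p.1))))
      ((volume.restrict (Ioc 0 M)).prod (volume.restrict (Ioi 0))) := by
  rw [integrable_prod_iff (by fun_prop)]
  constructor
  · filter_upwards [ae_restrict_mem measurableSet_Ioc] with v hv
    have h := integrableOn_rpow_mul_exp_neg_mul_rpow (p := 1) (b := v) (s := α - 1)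
      (by linarith) one_pos hv.1
    refine Integrable.const_mul (h.congr (ae_of_all _ fun s => ?_)) _
    simp only [rpow_one]
    ring_nf
  · have hint : IntegrableOn (fun v : ℝ => v ^ (1 - α) * Gamma α) (Ioc 0 M) :=
      ((intervalIntegrable_iff_integrableOn_Ioc_of_le hM).1
        (intervalIntegral.intervalIntegrable_rpow' (by linarith))).mul_const _
    refine hint.mono' (AEStronglyMeasurable.integral_prod_right' (f := fun p : ℝ × ℝ =>
      ‖sin p.1 * (p.2 ^ (α - 1) * exp (-(p.2 * p.1)))‖) (by fun_prop)) ?_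
    filter_upwards [ae_restrict_mem measurableSet_Ioc] with v hv
    have hv0 : 0 < v := hv.1
    have heq : ∫ s in Ioi (0 : ℝ), ‖sin v * (s ^ (α - 1) * exp (-(s * v)))‖ =
        |sin v| * (v ^ (-α) * Gamma α) := by
      rw [← integral_exp_neg_mul_rpow_eq hα hv0, ← integral_const_mul]
      refine setIntegral_congr_fun measurableSet_Ioi fun s hs => ?_
      have hs : 0 < s := hs
      rw [norm_mul, norm_of_nonneg (r := s ^ (α - 1) * exp (-(s * v))) (by positivity), norm_eq_abs]
    have hΓ := Gamma_pos_of_pos hα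
    rw [heq, norm_of_nonneg (by positivity), sub_eq_add_neg, rpow_add hv0, rpow_one, mul_assoc]
    have : |sin v| ≤ v := by simpa [abs_of_pos hv0] using abs_sin_le_abs (x := v)
    gcongr

theorem integral_sin_mul_rpow_neg {α : ℝ} (hα : 0 < α) (hα2 : α < 2) (k : ℕ) :
    ∫ v in Ioc (0 : ℝ) (k * (2 * π)), sin v * v ^ (-α) =
      (∫ s in Ioi (0 : ℝ), s ^ (α - 1) / (1 + s ^ 2) * (1 - exp (-(s * (k * (2 * π)))))) /
        Gamma α := by
  have hM : (0 : ℝ) ≤ k * (2 * π) := by positivity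
  have h := integral_integral_swap
    (f := fun v s : ℝ => sin v * (s ^ (α - 1) * exp (-(s * v)))) (integrable_sin_mul_rpow_mul_exp hα hα2 hM)
  have hl : ∫ v in Ioc (0 : ℝ) (k * (2 * π)), ∫ s in Ioi (0 : ℝ),
      sin v * (s ^ (α - 1) * exp (-(s * v))) =
      (∫ v in Ioc (0 : ℝ) (k * (2 * π)), sin v * v ^ (-α)) * Gamma α := by
    rw [← integral_mul_const]
    refine setIntegral_congr_fun measurableSet_Ioc fun v hv => ?_
    rw [integral_const_mul, integral_exp_neg_mul_rpow_eq hα hv.1, mul_assoc]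
  have hΓ := Gamma_pos_of_pos hα
  rw [eq_div_iff hΓ.ne', ← hl, h]
  refine setIntegral_congr_fun measurableSet_Ioi fun s hs => ?_
  have h2 := integral_sin_mul_exp_neg_mul k s
  rw [intervalIntegral.integral_of_le hM] at h2
  simp_rw [show ∀ v : ℝ, sin v * (s ^ (α - 1) * exp (-(s * v))) =
    s ^ (α - 1) * (sin v * exp (-(s * v))) by intro v; ring]
  rw [integral_const_mul, h2]
  ring

theorem tendsto_integral_sin_mul_rpow_neg {α : ℝ} (hα : 0 < α) (hα2 : α < 2) :
    Tendsto (fun k : ℕ => ∫ v in Ioc (0 : ℝ) (k * (2 * π)), sin v * v ^ (-α)) atTop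
      (nhds (π / (2 * (Gamma α * sin (π * α / 2))))) := by
  have hL : π / (2 * (Gamma α * sin (π * α / 2))) =
      (∫ s in Ioi (0 : ℝ), s ^ (α - 1) / (1 + s ^ 2)) / Gamma α := by
    rw [integral_rpow_div_one_add_sq hα hα2, div_div]; ring_nf
  rw [hL]
  simp_rw [integral_sin_mul_rpow_neg hα hα2]
  refine Tendsto.div_const ?_ _
  refine tendsto_integral_of_dominated_convergence (fun s => s ^ (α - 1) / (1 + s ^ 2))
    (fun k => by
      refine Measurable.aestronglyMeasurable ?_
      fun_prop) (integrableOn_rpow_div_one_add_sq hα hα2) (fun k => ?_) ?_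
  · filter_upwards [ae_restrict_mem measurableSet_Ioi] with s hs
    have hs : 0 < s := hs
    have h1 : exp (-(s * (k * (2 * π)))) ≤ 1 := exp_le_one_iff.2 (by
      have : 0 ≤ s * (k * (2 * π)) := by positivity
      linarith)
    have h2 := exp_pos (-(s * (k * (2 * π))))
    rw [norm_mul, norm_of_nonneg (r := s ^ (α - 1) / (1 + s ^ 2)) (by positivity),
      norm_of_nonneg (by linarith)]
    exact mul_le_of_le_one_right (by positivity) (by linarith)
  · filter_upwards [ae_restrict_mem measurableSet_Ioi] with s hs
    have hs : 0 < s := hs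
    have h1 : Tendsto (fun k : ℕ => s * ((k : ℝ) * (2 * π))) atTop atTop :=
      (tendsto_natCast_atTop_atTop.atTop_mul_const (by positivity)).const_mul_atTop hs
    have h2 := (tendsto_exp_neg_atTop_nhds_zero.comp h1).const_sub 1
    simpa using h2.const_mul (s ^ (α - 1) / (1 + s ^ 2))

end SineIntegral

section Tauberian

open Set

/-- Dominated convergence for the rescaled regularly varying tail over a bounded interval. -/
theorem tendsto_integral_sin_mul_div_of_regularlyVarying {G : ℝ → ℝ} {α : ℝ} (hα0 : 0 < α)
    (hα2 : α < 2) (hanti : Antitone G) (hpos : ∀ x > 0, 0 < G x)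
    (hrv : ∀ c > (0 : ℝ), Tendsto (fun x => G (c * x) / G x) atTop (nhds (c ^ (-α)))) (M : ℝ) :
    Tendsto (fun x => ∫ v in Ioc 0 M, Real.sin v * (G (v * x) / G x)) atTop
      (nhds (∫ v in Ioc 0 M, Real.sin v * v ^ (-α))) := by
  obtain ⟨β, hαβ, hβ2⟩ := exists_between hα2
  have hβ0 : 0 < β := hα0.trans hαβ
  obtain ⟨C, X, hC, hX, hCX⟩ :=
    exists_rpow_mul_le_of_regularlyVarying hanti hpos (hrv 2 two_pos) hβ0 hαβ
  have hint : IntegrableOn (fun v : ℝ => C * v ^ (1 - β) + 1) (Ioc 0 M) := by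
    rcases le_total 0 M with hM | hM
    · exact (((intervalIntegrable_iff_integrableOn_Ioc_of_le hM).1
        (intervalIntegral.intervalIntegrable_rpow' (by linarith))).const_mul C).add
        (integrableOn_const (by simp))
    · simp [Ioc_eq_empty_of_le hM]
  refine tendsto_integral_filter_of_dominated_convergence _ ?_ ?_ hint ?_
  · refine Eventually.of_forall fun x => Measurable.aestronglyMeasurable ?_
    have := hanti.measurable
    fun_prop
  · filter_upwards [eventually_ge_atTop X] with x hx
    filter_upwards [ae_restrict_mem measurableSet_Ioc] with v hv
    have hv0 : 0 < v := hv.1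
    have hx0 : 0 < x := hX.trans_le hx
    have hGx := hpos x hx0
    have hGv := hpos (v * x) (by positivity)
    rw [norm_mul, Real.norm_eq_abs, Real.norm_of_nonneg (by positivity)]
    rcases le_total v 1 with h | h
    · have hsin : |Real.sin v| ≤ v := by
        simpa [abs_of_pos hv0] using Real.abs_sin_le_abs (x := v)
      have hvx := hCX x hx (v * x) (by positivity) (mul_le_of_le_one_left hx0.le h)
      have hG : G (v * x) / G x ≤ C * v ^ (-β) := by
        rw [Real.mul_rpow hv0.le hx0.le] at hvx
        have hxβ : 0 < x ^ β := by positivity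
        have hvβ : 0 < v ^ β := by positivity
        rw [div_le_iff₀ hGx, Real.rpow_neg hv0.le, mul_right_comm, ← div_eq_mul_inv,
          le_div_iff₀ hvβ]
        refine le_of_mul_le_mul_left ?_ hxβ
        linarith
      calc |Real.sin v| * (G (v * x) / G x) ≤ v * (C * v ^ (-β)) := by gcongr
        _ = C * v ^ (1 - β) := by rw [sub_eq_add_neg, Real.rpow_add hv0, Real.rpow_one]; ring
        _ ≤ C * v ^ (1 - β) + 1 := by linarith
    · have hG : G (v * x) / G x ≤ 1 :=
        (div_le_one hGx).2 (hanti (le_mul_of_one_le_left hx0.le h))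
      have : 0 ≤ C * v ^ (1 - β) := by positivity
      have := mul_le_one₀ (Real.abs_sin_le_one v) (by positivity) hG
      linarith
  · filter_upwards [ae_restrict_mem measurableSet_Ioc] with v hv
    exact (hrv v hv.1).const_mul _

variable {μ : Measure ℝ}

theorem measureReal_le_abs_eq_two_mul [IsFiniteMeasure μ] (hsymm : μ.map (fun x => -x) = μ)
    {y : ℝ} (hy : 0 < y) : μ.real {x | y ≤ |x|} = 2 * μ.real (Ici y) := by
  have hset : {x : ℝ | y ≤ |x|} = Ici y ∪ Iic (-y) := by
    ext x
    simp only [mem_ofPred_eq, mem_union, mem_Ici, mem_Iic, le_abs, le_neg]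
  have hneg : μ.real (Iic (-y)) = μ.real (Ici y) := by
    conv_lhs => rw [← hsymm]
    rw [map_measureReal_apply measurable_neg measurableSet_Iic]
    congr 1
    ext x
    simp
  rw [hset, measureReal_union _ measurableSet_Iic, hneg, two_mul]
  exact disjoint_left.2 fun x hx hx' => by
    simp only [mem_Ici, mem_Iic] at hx hx'
    linarith

theorem integral_indicator_le_sin {M : ℝ} (hM : Real.cos M = 1) (hM0 : 0 ≤ M) {u : ℝ}
    (hu : 0 ≤ u) :
    ∫ v in Ioc 0 M, (if v ≤ u then Real.sin v else 0) =
      if u ≤ M then 1 - Real.cos u else 0 := by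
  have h1 : ∫ v in Ioc 0 M, (if v ≤ u then Real.sin v else 0) =
      ∫ v in (0 : ℝ)..(min M u), Real.sin v := by
    rw [intervalIntegral.integral_of_le (le_min hM0 hu), ← Ioc_inter_Iic,
      ← setIntegral_indicator measurableSet_Iic]
    rfl
  rw [h1, integral_sin, Real.cos_zero]
  split_ifs with h
  · rw [min_eq_right h]
  · rw [min_eq_left (not_le.1 h).le, hM, sub_self]

/-- Truncated layer-cake formula for `∫ (1 - cos (t x)) μ(dx)`. -/
theorem abs_integral_one_sub_cos_sub_le [IsFiniteMeasure μ] (hsymm : μ.map (fun x => -x) = μ)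
    {M : ℝ} (hM : Real.cos M = 1) (hM0 : 0 < M) {t : ℝ} (ht : 0 < t) :
    |(∫ x, (1 - Real.cos (t * x)) ∂μ) -
      2 * ∫ v in Ioc 0 M, Real.sin v * μ.real (Ici (v * t⁻¹))| ≤ 4 * μ.real (Ici (M * t⁻¹)) := by
  have hle : ∀ v x : ℝ, v ≤ t * |x| ↔ v * t⁻¹ ≤ |x| := fun v x => by
    rw [← div_eq_mul_inv, div_le_iff₀' ht]
  have hmeas : ∀ y : ℝ, MeasurableSet {x : ℝ | y ≤ |x|} := fun y =>
    measurableSet_le measurable_const (by fun_prop)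
  have hint : Integrable
      (Function.uncurry fun v x : ℝ => if v ≤ t * |x| then Real.sin v else 0)
      ((volume.restrict (Ioc 0 M)).prod μ) := by
    refine (integrable_const (1 : ℝ)).mono' (Measurable.aestronglyMeasurable ?_)
      (ae_of_all _ fun p => ?_)
    · exact Measurable.ite (measurableSet_le (by fun_prop) (by fun_prop)) (by fun_prop)
        measurable_const
    · simp only [Function.uncurry]
      split_ifs
      · exact Real.abs_sin_le_one _
      · simp
  have hswap := integral_integral_swap hint
  have hleft : ∫ v in Ioc 0 M, ∫ x, (if v ≤ t * |x| then Real.sin v else 0) ∂μ =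
      2 * ∫ v in Ioc 0 M, Real.sin v * μ.real (Ici (v * t⁻¹)) := by
    rw [← integral_const_mul]
    refine setIntegral_congr_fun measurableSet_Ioc fun v hv => ?_
    have hvt : 0 < v * t⁻¹ := mul_pos hv.1 (inv_pos.2 ht)
    have : ∀ x : ℝ, (if v ≤ t * |x| then Real.sin v else 0) =
        {x : ℝ | v * t⁻¹ ≤ |x|}.indicator (fun _ => Real.sin v) x := fun x => by
      simp only [indicator, mem_ofPred_eq, hle]
    simp_rw [this]
    rw [integral_indicator_const _ (hmeas _), measureReal_le_abs_eq_two_mul hsymm hvt, smul_eq_mul]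
    ring
  have hright : ∀ x : ℝ, ∫ v in Ioc 0 M, (if v ≤ t * |x| then Real.sin v else 0) =
      if t * |x| ≤ M then 1 - Real.cos (t * x) else 0 := fun x => by
    rw [integral_indicator_le_sin hM hM0.le (by positivity)]
    congr 2
    rw [← Real.cos_abs (t * x), abs_mul, abs_of_pos ht]
  simp_rw [hright] at hswap
  have hcos : Integrable (fun x => 1 - Real.cos (t * x)) μ :=
    (integrable_const (2 : ℝ)).mono' (by fun_prop) (ae_of_all _ fun x => by
      have h1 := Real.cos_le_one (t * x)
      have h2 := Real.neg_one_le_cos (t * x)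
      rw [Real.norm_of_nonneg (by linarith)]
      linarith)
  have htrunc : Integrable (fun x => if t * |x| ≤ M then 1 - Real.cos (t * x) else 0) μ :=
    hcos.indicator (measurableSet_le (f := fun x : ℝ => t * |x|) (by fun_prop) measurable_const)
  rw [← hleft, hswap, ← integral_sub hcos htrunc, ← Real.norm_eq_abs]
  have hMt : 0 < M * t⁻¹ := mul_pos hM0 (inv_pos.2 ht)
  have hbound : ∫ x, {x : ℝ | M * t⁻¹ ≤ |x|}.indicator (fun _ => (2 : ℝ)) x ∂μ =
      4 * μ.real (Ici (M * t⁻¹)) := by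
    rw [integral_indicator_const _ (hmeas _), measureReal_le_abs_eq_two_mul hsymm hMt, smul_eq_mul]
    ring
  rw [← hbound]
  refine norm_integral_le_of_norm_le ((integrable_const 2).indicator (hmeas _))
    (ae_of_all _ fun x => ?_)
  simp only [indicator, mem_ofPred_eq, ← hle]
  have h1 := Real.cos_le_one (t * x)
  have h2 := Real.neg_one_le_cos (t * x)
  split_ifs with h h' h'
  · simp
  · simp
  · rw [sub_zero, Real.norm_of_nonneg (by linarith)]
    linarith
  · exact absurd (not_le.1 h).le h'

/-- Abelian theorem for `∫ (1 - cos (t x)) μ(dx)` with a regularly varying tail. -/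
theorem tendsto_integral_one_sub_cos_div [IsFiniteMeasure μ] (hsymm : μ.map (fun x => -x) = μ)
    {α : ℝ} (hα0 : 0 < α) (hα2 : α < 2) (hpos : ∀ x > (0 : ℝ), 0 < μ.real (Ici x))
    (hrv : ∀ c > (0 : ℝ),
      Tendsto (fun x => μ.real (Ici (c * x)) / μ.real (Ici x)) atTop (nhds (c ^ (-α)))) :
    Tendsto (fun t => (∫ x, (1 - Real.cos (t * x)) ∂μ) / μ.real (Ici t⁻¹))
      (nhdsWithin 0 (Ioi 0))
      (nhds (Real.pi / (Real.Gamma α * Real.sin (Real.pi * α / 2)))) := by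
  set L := Real.pi / (Real.Gamma α * Real.sin (Real.pi * α / 2)) with hL
  have hanti : Antitone fun x => μ.real (Ici x) := fun x y hxy =>
    measureReal_mono (Ici_subset_Ici.2 hxy)
  have hI : Tendsto (fun k : ℕ =>
      2 * ∫ v in Ioc (0 : ℝ) (k * (2 * Real.pi)), Real.sin v * v ^ (-α)) atTop (nhds L) := by
    convert (tendsto_integral_sin_mul_rpow_neg hα0 hα2).const_mul 2 using 2
    rw [hL, ← div_div, ← div_div, ← div_div]
    ring
  have hE : Tendsto (fun k : ℕ => 4 * ((k : ℝ) * (2 * Real.pi)) ^ (-α)) atTop (nhds 0) := by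
    have h1 : Tendsto (fun k : ℕ => (k : ℝ) * (2 * Real.pi)) atTop atTop :=
      tendsto_natCast_atTop_atTop.atTop_mul_const (by positivity)
    simpa using ((tendsto_rpow_neg_atTop hα0).comp h1).const_mul 4
  rw [Metric.tendsto_nhds]
  intro ε hε
  obtain ⟨k, hk1, hk2, hk3⟩ := ((Metric.tendsto_nhds.1 hI (ε / 4) (by positivity)).and
    ((hE.eventually (gt_mem_nhds (show (0 : ℝ) < ε / 4 by positivity))).and
      (eventually_ge_atTop 1))).exists
  set M : ℝ := k * (2 * Real.pi) with hMdef
  have hM0 : 0 < M := by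
    have : (0 : ℝ) < k := by exact_mod_cast hk3
    positivity
  have hJ := (tendsto_integral_sin_mul_div_of_regularlyVarying hα0 hα2 hanti hpos hrv M).const_mul 2
  have hG := (hrv M hM0).const_mul 4
  filter_upwards [tendsto_inv_nhdsGT_zero.eventually
    ((Metric.tendsto_nhds.1 hJ (ε / 4) (by positivity)).and
      (hG.eventually (gt_mem_nhds hk2))), self_mem_nhdsWithin] with t ⟨hJt, hGt⟩ ht
  have ht0 : 0 < t := ht
  have hGpos := hpos t⁻¹ (inv_pos.2 ht0)
  have hlayer := abs_integral_one_sub_cos_sub_le hsymm (Real.cos_nat_mul_two_pi k) hM0 ht0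
  rw [← hMdef] at hlayer
  have hdiv : |(∫ x, (1 - Real.cos (t * x)) ∂μ) / μ.real (Ici t⁻¹) -
      2 * ∫ v in Ioc 0 M, Real.sin v * (μ.real (Ici (v * t⁻¹)) / μ.real (Ici t⁻¹))| ≤
      4 * (μ.real (Ici (M * t⁻¹)) / μ.real (Ici t⁻¹)) := by
    simp_rw [← mul_div_assoc]
    rw [integral_div, ← mul_div_assoc, ← sub_div, abs_div, abs_of_pos hGpos]
    gcongr
  rw [Real.dist_eq] at hJt hk1 ⊢
  rw [abs_lt] at hJt hk1 ⊢
  rw [abs_le] at hdiv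
  constructor <;> linarith [hdiv.1, hdiv.2, hJt.1, hJt.2, hk1.1, hk1.2]

theorem isBigO_of_tendsto_div_of_even {f : ℝ → ℝ} {G : ℝ → ℝ} {α l : ℝ}
    (hf0 : f 0 = 0) (hf : ∀ t, f (-t) = f t) (hanti : Antitone G) (hpos : ∀ x > 0, 0 < G x)
    (hrv : Tendsto (fun x => G (2 * x) / G x) atTop (nhds ((2 : ℝ) ^ (-α))))
    (hlim : Tendsto (fun t => f t / G t⁻¹) (nhdsWithin 0 (Ioi 0)) (nhds l))
    {ε : ℝ} (hε0 : 0 < ε) (hε : ε < α) :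
    f =O[nhds 0] fun t => |t| ^ ε := by
  obtain ⟨C, X, hX, hCX⟩ := exists_rpow_mul_bounded_of_regularlyVarying hanti hpos hrv hε0 hε
  have hpt : ∀ᶠ t in nhdsWithin 0 (Ioi 0), |f t| ≤ (|l| + 1) * C * t ^ ε := by
    filter_upwards [hlim.abs.eventually (gt_mem_nhds (lt_add_one |l|)),
      tendsto_inv_nhdsGT_zero.eventually (eventually_ge_atTop X), self_mem_nhdsWithin]
      with t h1 h2 ht
    have ht0 : 0 < t := ht
    have hG := hpos t⁻¹ (inv_pos.2 ht0)
    have h3 := hCX _ h2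
    rw [abs_div, abs_of_pos hG, div_lt_iff₀ hG] at h1
    rw [Real.inv_rpow ht0.le, inv_mul_le_iff₀ (by positivity)] at h3
    calc |f t| ≤ (|l| + 1) * G t⁻¹ := h1.le
      _ ≤ (|l| + 1) * (t ^ ε * C) := by gcongr
      _ = _ := by ring
  obtain ⟨δ, hδ, hsub⟩ := mem_nhdsGT_iff_exists_Ioo_subset.1 hpt
  refine Asymptotics.IsBigO.of_bound ((|l| + 1) * C) ?_
  filter_upwards [Ioo_mem_nhds (neg_lt_zero.2 hδ) hδ] with t ht
  rw [Real.norm_eq_abs, Real.norm_of_nonneg (by positivity)]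
  rcases lt_trichotomy t 0 with h | h | h
  · rw [← hf t, abs_of_neg h]
    exact hsub ⟨by linarith, by linarith [ht.1]⟩
  · simp [h, hf0, Real.zero_rpow hε0.ne']
  · rw [abs_of_pos h]
    exact hsub ⟨h, ht.2⟩

theorem eq_integral_cos_of_ofReal_eq [IsFiniteMeasure μ] {r t : ℝ}
    (h : (r : ℂ) = ∫ x : ℝ, Complex.exp (Complex.I * t * x) ∂μ) :
    r = ∫ x, Real.cos (t * x) ∂μ := by
  have hform : ∀ x : ℝ, Complex.I * t * x = ((t * x : ℝ) : ℂ) * Complex.I := fun x => by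
    push_cast
    ring
  simp_rw [hform] at h
  have hint : Integrable (fun x : ℝ => Complex.exp (((t * x : ℝ) : ℂ) * Complex.I)) μ :=
    (integrable_const (1 : ℝ)).mono' (by fun_prop) (ae_of_all _ fun x => by
      rw [Complex.norm_exp_ofReal_mul_I])
  have hre := congrArg Complex.re h
  rw [Complex.ofReal_re, ← RCLike.re_eq_complex_re, ← integral_re hint] at hre
  simpa only [RCLike.re_eq_complex_re, Complex.exp_ofReal_mul_I_re] using hre

end Tauberian

/-- if the upper tail of `μ` is regularly varying at `∞` with index `-α`,
`0 < α < 2`, then `R(0) - R(t) ~ C_α μ([t⁻¹, ∞))` as `t ↓ 0`, where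
`C_α = π / (Γ(α) sin(πα/2))`; consequently `R(t) = R(0) + O(|t|^ε)` as `t → 0` for every
`ε ∈ (0, α)`. -/
theorem excursion_stmt6
    (α : ℝ) (hα0 : 0 < α) (hα2 : α < 2)
    (μ : Measure ℝ) [IsFiniteMeasure μ]
    (hμ_nonnull : μ Set.univ ≠ 0)
    (hμ_symm : μ.map (fun x => -x) = μ)
    (hμ_tail_pos : ∀ x > (0 : ℝ), 0 < μ (Set.Ici x))
    (hμ_rv : ∀ c > (0 : ℝ),
      Tendsto (fun x : ℝ => (μ (Set.Ici (c * x))).toReal / (μ (Set.Ici x)).toReal)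
        atTop (nhds (c ^ (-α))))
    (R : ℝ → ℝ)
    (hR : ∀ t : ℝ, (R t : ℂ) = ∫ x : ℝ, Complex.exp (Complex.I * t * x) ∂μ) :
    Tendsto (fun t : ℝ =>
        (R 0 - R t) /
          (Real.pi / (Real.Gamma α * Real.sin (Real.pi * α / 2))
            * (μ (Set.Ici t⁻¹)).toReal))
      (nhdsWithin 0 (Set.Ioi 0)) (nhds 1) ∧
    ∀ ε ∈ Set.Ioo (0 : ℝ) α,
      (fun t : ℝ => R t - R 0) =O[nhds 0] fun t : ℝ => |t| ^ ε := by
  have hcos : ∀ t, R t = ∫ x, Real.cos (t * x) ∂μ := fun t => eq_integral_cos_of_ofReal_eq (hR t)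
  have hsub : ∀ t, R 0 - R t = ∫ x, (1 - Real.cos (t * x)) ∂μ := fun t => by
    have hint : Integrable (fun x => Real.cos (t * x)) μ :=
      (integrable_const (1 : ℝ)).mono' (by fun_prop)
        (ae_of_all _ fun x => Real.abs_cos_le_one _)
    rw [integral_sub (integrable_const 1) hint, hcos, hcos]
    simp
  have hpos : ∀ x > (0 : ℝ), 0 < μ.real (Set.Ici x) := fun x hx =>
    ENNReal.toReal_pos (hμ_tail_pos x hx).ne' (measure_ne_top _ _)
  have hlim := tendsto_integral_one_sub_cos_div hμ_symm hα0 hα2 hpos hμ_rv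
  have hC : Real.pi / (Real.Gamma α * Real.sin (Real.pi * α / 2)) ≠ 0 := by
    have h1 := Real.Gamma_pos_of_pos hα0
    have h2 : 0 < Real.sin (Real.pi * α / 2) :=
      Real.sin_pos_of_pos_of_lt_pi (by positivity) (by nlinarith [Real.pi_pos])
    positivity
  simp_rw [← hsub] at hlim
  refine ⟨?_, fun ε hε => ?_⟩
  · have h := hlim.div_const (Real.pi / (Real.Gamma α * Real.sin (Real.pi * α / 2)))
    rw [div_self hC] at h
    simp_rw [div_div, mul_comm (μ.real _)] at h
    exact h
  · have h := isBigO_of_tendsto_div_of_even (f := fun t => R 0 - R t) (sub_self _)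
      (fun t => by simp [hcos])
      (fun x y hxy => measureReal_mono (Set.Ici_subset_Ici.2 hxy)) hpos (hμ_rv 2 two_pos) hlim
      hε.1 hε.2
    simpa using h.neg_left
end
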